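/- arXiv:1912.10529 — 2 statements merged into one kernel-verified Lean document; each statement's English description precedes it below -/
import Mathlib

section
/- Let V be a centered random vector in R^p (p ≥ 2) admitting a Stein kernel τ, and let Z be a centered Gaussian random vector in R^p with covariance matrix Σ satisfying Σ_{jj} ≥ c for all j = 1,…,p and some constant c > 0. Then sup_{y ∈ R^p} |P(V ≤ y) − P(Z ≤ y)| ≤ C (Δ log² p)^{1/2}, where Δ = E[max_{1≤j,k≤p} |τ_{jk}(V) − Σ_{jk}|] and C is a constant depending only on c. -/
open MeasureTheory ProbabilityTheory

/-- First-order partial derivative `∂_j φ` of `φ : ℝ^p → ℝ`. -/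
noncomputable def pderiv1 {p : ℕ} (φ : (Fin p → ℝ) → ℝ) (j : Fin p)
    (x : Fin p → ℝ) : ℝ :=
  fderiv ℝ φ x (Pi.single j 1)

/-- Second-order partial derivative `∂_{jk} φ` of `φ : ℝ^p → ℝ`. -/
noncomputable def pderiv2 {p : ℕ} (φ : (Fin p → ℝ) → ℝ) (j k : Fin p)
    (x : Fin p → ℝ) : ℝ :=
  fderiv ℝ (pderiv1 φ j) x (Pi.single k 1)

/-- `φ` belongs to `C_b²(ℝ^p)`: twice continuously differentiable with `φ` and all
partial derivatives up to order two bounded. -/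
def MemCb2 {p : ℕ} (φ : (Fin p → ℝ) → ℝ) : Prop :=
  ContDiff ℝ 2 φ ∧ ∃ M : ℝ, ∀ x : Fin p → ℝ,
    |φ x| ≤ M ∧ (∀ j, |pderiv1 φ j x| ≤ M) ∧ ∀ j k, |pderiv2 φ j k x| ≤ M

/-- `τ` is a Stein kernel for the centered random vector `V` under `P`:
`Σ_j E[∂_j φ(V) V_j] = Σ_{j,k} E[∂_{jk} φ(V) τ_{jk}(V)]` for all `φ ∈ C_b²(ℝ^p)`. -/
def IsSteinKernel {Ω : Type} [MeasurableSpace Ω] (P : Measure Ω) {p : ℕ}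
    (V : Ω → Fin p → ℝ) (τ : (Fin p → ℝ) → Fin p → Fin p → ℝ) : Prop :=
  ∀ φ : (Fin p → ℝ) → ℝ, MemCb2 φ →
    (∑ j, ∫ ω, pderiv1 φ j (V ω) * V ω j ∂P) =
      ∑ j, ∑ k, ∫ ω, pderiv2 φ j k (V ω) * τ (V ω) j k ∂P

/-- `G` is a centered Gaussian random vector in `ℝ^p` with covariance matrix `S`. -/
def IsCenteredGaussianVec {Ω : Type} [MeasurableSpace Ω] (μ : Measure Ω) {p : ℕ}
    (G : Ω → Fin p → ℝ) (S : Fin p → Fin p → ℝ) : Prop :=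
  ∀ u : Fin p → ℝ,
    Measure.map (fun ω => ∑ j, u j * G ω j) μ =
      gaussianReal 0 (Real.toNNReal (∑ j, ∑ k, u j * S j k * u k))

lemma gaussianPDFReal_le_measure_Ioi {v : NNReal} (hv : v ≠ 0) {L s : ℝ} (hL : 0 ≤ L)
    (hs : s ≤ L * √(v : ℝ)) :
    gaussianPDFReal 0 v s ≤
      Real.exp (3 / 2) * (L + 1) / √(v : ℝ) * (gaussianReal 0 v).real (Set.Ioi s) := by
  have hvpos : (0 : ℝ) < v := by positivity
  set σ := √(v : ℝ) with hσdef
  have hσ : 0 < σ := Real.sqrt_pos.2 hvpos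
  have hσ2 : σ ^ 2 = v := Real.sq_sqrt hvpos.le
  set η := σ / (L + 1) with hη
  have hηpos : 0 < η := by positivity
  have hησ : η * (L + 1) = σ := by rw [hη]; field_simp
  have key : ∀ u ∈ Set.Ioc s (s + η),
      Real.exp (-(3 / 2)) * gaussianPDFReal 0 v s ≤ gaussianPDFReal 0 v u := by
    rintro u ⟨h1, h2⟩
    have hsq : u ^ 2 ≤ s ^ 2 + 3 * v := by
      rw [← hσ2]
      rcases le_total (u + s) 0 with h | h
      · nlinarith
      · have h3 : u + s ≤ 2 * L * σ + η := by linarith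
        have h4 : (u - s) * (u + s) ≤ η * (2 * L * σ + η) := by
          apply mul_le_mul _ h3 h hηpos.le; linarith
        have h5 : η ≤ σ := by nlinarith
        nlinarith [mul_nonneg hηpos.le hL]
    have e : Real.exp (-(3 / 2)) * gaussianPDFReal 0 v s =
        (√(2 * Real.pi * v))⁻¹ * Real.exp (-(3 / 2) + -s ^ 2 / (2 * v)) := by
      rw [gaussianPDFReal, Real.exp_add]; simp only [sub_zero]; ring
    rw [e, gaussianPDFReal]
    gcongr
    simp only [sub_zero]
    rw [← sub_nonneg]
    have : -u ^ 2 / (2 * (v : ℝ)) - (-(3 / 2) + -s ^ 2 / (2 * v)) =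
        (s ^ 2 + 3 * v - u ^ 2) / (2 * v) := by field_simp; ring
    rw [this]
    apply div_nonneg <;> linarith
  have h1 : η * (Real.exp (-(3 / 2)) * gaussianPDFReal 0 v s) ≤
      (gaussianReal 0 v).real (Set.Ioi s) := by
    calc _ ≤ ∫ u in Set.Ioc s (s + η), gaussianPDFReal 0 v u := by
          have := setIntegral_ge_of_const_le_real (μ := volume) measurableSet_Ioc (by simp) key
            (integrable_gaussianPDFReal 0 v).integrableOn
          simpa [mul_comm, hηpos.le] using this
      _ = (gaussianReal 0 v).real (Set.Ioc s (s + η)) := by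
          rw [measureReal_def, gaussianReal_apply_eq_integral _ hv, ENNReal.toReal_ofReal]
          exact setIntegral_nonneg measurableSet_Ioc fun x _ => gaussianPDFReal_nonneg _ _ _
      _ ≤ _ := measureReal_mono Set.Ioc_subset_Ioi_self
  have h2 : Real.exp (3 / 2) * Real.exp (-(3 / 2)) = 1 := by rw [← Real.exp_add]; simp
  calc gaussianPDFReal 0 v s
      = Real.exp (3 / 2) * (L + 1) / σ * (η * (Real.exp (-(3 / 2)) * gaussianPDFReal 0 v s)) := by
        rw [hη]; field_simp; rw [mul_assoc, h2, mul_one]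
    _ ≤ _ := by gcongr

lemma gaussianReal_upperSet_inter_Ioc_le {v : NNReal} {c : ℝ} (hc : 0 < c) (hcv : c ≤ v)
    {p : ℕ} (hp : 1 ≤ p) {a δ : ℝ} (hδ : 0 ≤ δ) {U : Set ℝ} (hU : IsUpperSet U)
    (hUm : MeasurableSet U) :
    gaussianReal 0 v (U ∩ Set.Ioc a (a + δ)) ≤
      ENNReal.ofReal (δ / √c * (Real.exp (3 / 2) * (√(2 * Real.log p) + 1))) * gaussianReal 0 v U
        + ENNReal.ofReal (δ / √c / p) := by
  have hvpos : (0 : ℝ) < v := hc.trans_le hcv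
  have hv : v ≠ 0 := by rintro rfl; simp at hvpos
  set L := √(2 * Real.log p)
  have hL : 0 ≤ L := Real.sqrt_nonneg _
  have hp' : (1 : ℝ) ≤ p := by exact_mod_cast hp
  have hL2 : L ^ 2 = 2 * Real.log p := Real.sq_sqrt (by have := Real.log_nonneg hp'; linarith)
  have hσ : 0 < √(v : ℝ) := Real.sqrt_pos.2 hvpos
  have hcσ : √c ≤ √(v : ℝ) := Real.sqrt_le_sqrt hcv
  have hc' : 0 < √c := Real.sqrt_pos.2 hc
  set G := (gaussianReal 0 v).real U
  have hG : 0 ≤ G := measureReal_nonneg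
  have key : ∀ s ∈ U, gaussianPDFReal 0 v s ≤
      Real.exp (3 / 2) * (L + 1) / √c * G + 1 / √c / p := by
    intro s hs
    rcases le_or_gt s (L * √(v : ℝ)) with h | h
    · calc _ ≤ _ := gaussianPDFReal_le_measure_Ioi hv hL h
        _ ≤ Real.exp (3 / 2) * (L + 1) / √c * G := by
          gcongr
          exact measureReal_mono (fun x hx => hU (le_of_lt hx) hs) 
        _ ≤ _ := by linarith [show 0 ≤ 1 / √c / p by positivity]
    · have : gaussianPDFReal 0 v s ≤ 1 / √c / p := by
        rw [gaussianPDFReal, div_div, one_div, mul_inv]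
        gcongr
        · have := mul_le_mul_of_nonneg_right Real.pi_gt_three.le hvpos.le
          linarith
        · rw [← Real.exp_log (show (0 : ℝ) < p by linarith), ← Real.exp_neg]
          gcongr
          have h2 : 2 * Real.log p * v ≤ s ^ 2 := by
            have : (L * √(v : ℝ)) ^ 2 ≤ s ^ 2 := by gcongr
            rwa [mul_pow, hL2, Real.sq_sqrt hvpos.le] at this
          rw [div_le_iff₀ (by positivity)]
          simp only [sub_zero]
          linarith
      have : 0 ≤ Real.exp (3 / 2) * (L + 1) / √c * G := by positivity
      linarith
  have hmeas : MeasurableSet (U ∩ Set.Ioc a (a + δ)) := hUm.inter measurableSet_Ioc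
  rw [gaussianReal_apply _ hv]
  calc _ ≤ ∫⁻ x in U ∩ Set.Ioc a (a + δ),
        ENNReal.ofReal (Real.exp (3 / 2) * (L + 1) / √c * G + 1 / √c / p) :=
        setLIntegral_mono measurable_const fun x hx => ENNReal.ofReal_le_ofReal (key x hx.1)
    _ ≤ ENNReal.ofReal (Real.exp (3 / 2) * (L + 1) / √c * G + 1 / √c / p) * ENNReal.ofReal δ := by
        rw [setLIntegral_const]
        gcongr
        refine (measure_mono Set.inter_subset_right).trans ?_
        simp
    _ = _ := by
        rw [← ENNReal.ofReal_mul (by positivity), show gaussianReal 0 v U = ENNReal.ofReal G by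
          simp [G], ← ENNReal.ofReal_mul (by positivity), ← ENNReal.ofReal_add (by positivity)
          (by positivity)]
        congr 1
        ring

lemma integral_id_mul_gaussianReal {v : NNReal} (hv : v ≠ 0) {g g' : ℝ → ℝ} {M : ℝ}
    (hg : ∀ s, HasDerivAt g (g' s) s) (hg' : Measurable g') (hM : ∀ s, |g s| ≤ M)
    (hM' : ∀ s, |g' s| ≤ M) :
    ∫ s, s * g s ∂gaussianReal 0 v = v * ∫ s, g' s ∂gaussianReal 0 v := by
  have hvpos : (0 : ℝ) < v := by positivity
  have hgm : Measurable g := (continuous_iff_continuousAt.2 fun s => (hg s).continuousAt).measurable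
  have hd : ∀ s, HasDerivAt (gaussianPDFReal 0 v) (-(s / v) * gaussianPDFReal 0 v s) s := by
    intro s
    have h1 : HasDerivAt (fun x : ℝ => -(x - 0) ^ 2 / (2 * (v : ℝ))) (-(s / v)) s := by
      have := (((hasDerivAt_id s).sub_const 0).pow 2).neg.div_const (2 * (v : ℝ))
      convert! this using 1
      simp; field_simp
    have := (h1.exp).const_mul ((√(2 * Real.pi * v))⁻¹)
    convert! this using 1
    rw [gaussianPDFReal]; ring
  have hint : Integrable (fun s => s * gaussianPDFReal 0 v s) := by
    have := (memLp_id_gaussianReal (μ := 0) (v := v) 1).integrable le_rfl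
    rw [gaussianReal_of_var_ne_zero _ hv, integrable_withDensity_iff_integrable_smul₀'
      (by fun_prop) (by simp [gaussianPDF])] at this
    simpa [mul_comm] using this
  have hint0 := integrable_gaussianPDFReal 0 v
  have hb : ∀ (f k : ℝ → ℝ), Integrable k → Measurable f → (∀ s, |f s| ≤ M) →
      Integrable (f * k) := fun f k hk hf hfM =>
    hk.bdd_mul (c := M) hf.aestronglyMeasurable (.of_forall hfM)
  have h := integral_mul_deriv_eq_deriv_mul_of_integrable (u := g) (u' := g')
    (v := gaussianPDFReal 0 v) (v' := fun s => -(s / v) * gaussianPDFReal 0 v s)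
    (fun s _ => hg s) (fun s _ => hd s)
    (hb _ _ ((hint.const_mul (-(1 / v : ℝ))).congr (.of_forall fun s => by simp; ring)) hgm hM)
    (hb _ _ hint0 hg' hM') (hb _ _ hint0 hgm hM)
  rw [integral_gaussianReal_eq_integral_smul hv, integral_gaussianReal_eq_integral_smul hv]
  have e1 : ∫ s, gaussianPDFReal 0 v s • (s * g s) =
      -(v * ∫ s, g s * (-(s / v) * gaussianPDFReal 0 v s)) := by
    rw [← integral_const_mul, ← integral_neg]
    congr 1; ext s; simp; field_simp
  rw [e1, h]
  simp [mul_comm]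

lemma exists_map_eq_map_prod_gaussianReal {p : ℕ} (ν : Measure (Fin p → ℝ)) [IsGaussian ν]
    (hν : ∀ j, ∫ z, z j ∂ν = 0) (j : Fin p) (hj : Var[fun z => z j; ν] ≠ 0) :
    ∃ ρ : Measure (Fin p → ℝ), IsProbabilityMeasure ρ ∧
      ν.map (fun z => (z j, z)) =
        ((gaussianReal 0 Var[fun z => z j; ν].toNNReal).prod ρ).map (fun q =>
          (q.1, fun k => q.1 * (cov[fun z => z j, fun z => z k; ν] / Var[fun z => z j; ν])
            + q.2 k)) := by
  set b : Fin p → ℝ := fun k => cov[fun z => z j, fun z => z k; ν] / Var[fun z => z j; ν]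
  have hid : HasGaussianLaw (id : (Fin p → ℝ) → (Fin p → ℝ)) ν := IsGaussian.hasGaussianLaw_id
  let R : (Fin p → ℝ) → Fin p → ℝ := fun z k => z k - z j * b k
  have hR : Measurable R := by fun_prop
  have hmem : ∀ k, MemLp (fun z : Fin p → ℝ => z k) 2 ν := fun k =>
    (hid.map_fun (ContinuousLinearMap.proj k)).memLp_two
  have hind : IndepFun (fun z : Fin p → ℝ => z j) R ν := by
    have h := HasGaussianLaw.indepFun_of_covariance_eval (P := ν) (ι := Unit) (κ := Fin p)
      (X := fun _ z => z j) (Y := fun k z => z k - z j * b k) ?_ ?_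
    · exact h.comp (measurable_pi_apply ()) measurable_id
    · let L : (Fin p → ℝ) →L[ℝ] (Unit → ℝ) × (Fin p → ℝ) :=
        (ContinuousLinearMap.pi fun _ => ContinuousLinearMap.proj j).prod
          (ContinuousLinearMap.pi fun k => ContinuousLinearMap.proj k -
            b k • ContinuousLinearMap.proj j)
      have h := hid.map_fun L
      have e : (fun z => L (id z)) = fun z : Fin p → ℝ =>
          ((fun _ => z j, fun k => z k - z j * b k) : (Unit → ℝ) × (Fin p → ℝ)) := by
        ext z <;> simp [L, mul_comm]
      rwa [e] at h
    · intro _ k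
      have h1 : (fun z : Fin p → ℝ => z k - z j * b k) = (fun z => z k) - (fun z => z j * b k) := rfl
      rw [h1, covariance_sub_right (hmem j) (hmem k) ((hmem j).mul_const _),
        covariance_mul_const_right, covariance_self (measurable_pi_apply j).aemeasurable]
      simp only [b]
      field_simp
      simp
  have hlaw : ν.map (fun z => z j) = gaussianReal 0 Var[fun z => z j; ν].toNNReal := by
    have := (hid.map_fun (ContinuousLinearMap.proj j)).map_eq_gaussianReal
    simpa [hν j] using this
  refine ⟨ν.map R, Measure.isProbabilityMeasure_map hR.aemeasurable, ?_⟩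
  rw [← hlaw, ← hind.map_prod_eq_prod_map_map (measurable_pi_apply j).aemeasurable hR.aemeasurable,
    Measure.map_map (by fun_prop) (by fun_prop)]
  congr 1
  ext z k <;> simp [R, b]

lemma covariance_le_sqrt_variance_mul {Ω : Type*} [MeasurableSpace Ω] {μ : Measure Ω}
    [IsProbabilityMeasure μ] {X Y : Ω → ℝ} (hX : MemLp X 2 μ) (hY : MemLp Y 2 μ)
    (hX0 : 0 < Var[X; μ]) (hY0 : 0 < Var[Y; μ]) :
    cov[X, Y; μ] ≤ √Var[X; μ] * √Var[Y; μ] := by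
  set s := √Var[X; μ] with hs
  set t := √Var[Y; μ] with ht
  have hs0 : 0 < s := Real.sqrt_pos.2 hX0
  have ht0 : 0 < t := Real.sqrt_pos.2 hY0
  have hs2 : Var[X; μ] = s ^ 2 := (Real.sq_sqrt hX0.le).symm
  have ht2 : Var[Y; μ] = t ^ 2 := (Real.sq_sqrt hY0.le).symm
  have h := variance_nonneg (t • X - s • Y) μ
  rw [variance_sub (hX.const_smul t) (hY.const_smul s), variance_smul, variance_smul,
    covariance_smul_left, covariance_smul_right, hs2, ht2] at h
  have h3 : 0 ≤ 2 * (s * t) * (s * t - cov[X, Y; μ]) := by linarith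
  have := nonneg_of_mul_nonneg_right h3 (by positivity)
  linarith

/-- **Nazarov's inequality**: anti-concentration of a Gaussian vector on orthant shells. -/
lemma gaussian_orthant_shell_le {c : ℝ} (hc : 0 < c) {p : ℕ} (hp : 1 ≤ p)
    (ν : Measure (Fin p → ℝ)) [IsGaussian ν]
    (hν : ∀ j, ∫ z, z j ∂ν = 0) (hvar : ∀ j, c ≤ Var[fun z => z j; ν])
    (a : Fin p → ℝ) {δ : ℝ} (hδ : 0 ≤ δ) :
    ν {z | (∀ j, z j ≤ a j + δ) ∧ ∃ j, a j < z j} ≤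
      ENNReal.ofReal (δ / √c * (Real.exp (3 / 2) * (√(2 * Real.log p) + 1) + 1)) := by
  have hid : HasGaussianLaw (id : (Fin p → ℝ) → (Fin p → ℝ)) ν := IsGaussian.hasGaussianLaw_id
  have hmem : ∀ k, MemLp (fun z : Fin p → ℝ => z k) 2 ν := fun k =>
    (hid.map_fun (ContinuousLinearMap.proj k)).memLp_two
  set σ : Fin p → ℝ := fun j => √Var[fun z => z j; ν] with hσdef
  have hσ : ∀ j, 0 < σ j := fun j => Real.sqrt_pos.2 (hc.trans_le (hvar j))
  let A : Fin p → Set (ℝ × (Fin p → ℝ)) := fun j =>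
    {q | (∀ k, (q.2 k - a k) / σ k ≤ (q.1 - a j) / σ j) ∧
      ∀ k, k < j → (q.2 k - a k) / σ k < (q.1 - a j) / σ j}
  have hA : ∀ j, MeasurableSet (A j) := fun j => by
    simp only [A, Set.ofPred_and, Set.ofPred_forall]
    refine MeasurableSet.inter ?_ ?_
    · exact MeasurableSet.iInter fun k => measurableSet_le (by fun_prop) (by fun_prop)
    · exact MeasurableSet.iInter fun k => MeasurableSet.iInter fun _ =>
        measurableSet_lt (by fun_prop) (by fun_prop)
  let E : Fin p → Set (Fin p → ℝ) := fun j => (fun z => (z j, z)) ⁻¹' A j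
  have hE : ∀ j, MeasurableSet (E j) := fun j => (by fun_prop : Measurable _) (hA j)
  have hdisj : Pairwise (Function.onFun Disjoint E) := by
    intro i j hij
    rw [Function.onFun, Set.disjoint_left]
    rintro z ⟨h1, h2⟩ ⟨h3, h4⟩
    rcases lt_or_gt_of_ne hij with h | h
    · exact absurd (h4 i h) (not_lt.2 (h1 j))
    · exact absurd (h2 j h) (not_lt.2 (h3 i))
  set K := Real.exp (3 / 2) * (√(2 * Real.log p) + 1) with hK
  have hcell : ∀ j, ν (E j ∩ {z | z j ∈ Set.Ioc (a j) (a j + δ)}) ≤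
      ENNReal.ofReal (δ / √c * K) * ν (E j) + ENNReal.ofReal (δ / √c / p) := by
    intro j
    obtain ⟨ρ, hρ, hmap⟩ := exists_map_eq_map_prod_gaussianReal ν hν j
      (hc.trans_le (hvar j)).ne'
    set v := Var[fun z => z j; ν].toNNReal
    have hv : c ≤ v := (hvar j).trans (Real.le_coe_toNNReal _)
    set Φ : ℝ × (Fin p → ℝ) → ℝ × (Fin p → ℝ) := fun q =>
          (q.1, fun k => q.1 * (cov[fun z => z j, fun z => z k; ν] / Var[fun z => z j; ν])
            + q.2 k) with hΦdef
    have hΦ : Measurable Φ := by fun_prop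
    have hB : MeasurableSet {q : ℝ × (Fin p → ℝ) | q.1 ∈ Set.Ioc (a j) (a j + δ)} :=
      measurable_fst measurableSet_Ioc
    have e1 : ν (E j) = ((gaussianReal 0 v).prod ρ) (Φ ⁻¹' A j) := by
      rw [← Measure.map_apply hΦ (hA j), ← hmap, Measure.map_apply (by fun_prop) (hA j)]
    have e2 : ν (E j ∩ {z | z j ∈ Set.Ioc (a j) (a j + δ)}) =
        ((gaussianReal 0 v).prod ρ)
          (Φ ⁻¹' (A j ∩ {q | q.1 ∈ Set.Ioc (a j) (a j + δ)})) := by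
      rw [← Measure.map_apply hΦ ((hA j).inter hB), ← hmap,
        Measure.map_apply (by fun_prop) ((hA j).inter hB)]
      rfl
    rw [e1, e2, Measure.prod_apply_symm (hΦ (hA j)),
      Measure.prod_apply_symm (hΦ ((hA j).inter hB)), ← lintegral_const_mul _
        (measurable_measure_prodMk_right (hΦ (hA j)))]
    have e3 : ENNReal.ofReal (δ / √c / p) = ∫⁻ _, ENNReal.ofReal (δ / √c / p) ∂ρ := by simp
    rw [e3, ← lintegral_add_right _ measurable_const]
    refine lintegral_mono fun r => ?_
    have hU : IsUpperSet ((fun s => (s, r)) ⁻¹' (Φ ⁻¹' A j)) := by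
      rintro s s' hss ⟨h1, h2⟩
      have hstep : ∀ k, ((Φ (s', r)).2 k - a k) / σ k - ((Φ (s, r)).2 k - a k) / σ k ≤
          ((Φ (s', r)).1 - a j) / σ j - ((Φ (s, r)).1 - a j) / σ j := by
        intro k
        have hcs := covariance_le_sqrt_variance_mul (hmem j) (hmem k)
          (hc.trans_le (hvar j)) (hc.trans_le (hvar k))
        have hv2 : Var[fun z => z j; ν] = σ j ^ 2 :=
          (Real.sq_sqrt (hc.trans_le (hvar j)).le).symm
        have h3 : cov[fun z => z j, fun z => z k; ν] / Var[fun z => z j; ν] / σ k ≤ 1 / σ j := by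
          rw [hv2, div_div, div_le_div_iff₀ (by have := hσ j; have := hσ k; positivity) (hσ j)]
          have := mul_le_mul_of_nonneg_right hcs (hσ j).le
          simp only [hσdef] at this ⊢
          linarith
        have h4 := mul_le_mul_of_nonneg_left h3 (sub_nonneg.2 hss)
        simp only [hΦdef]
        have := hσ j
        have := hσ k
        calc _ = (s' - s) * (cov[fun z => z j, fun z => z k; ν] / Var[fun z => z j; ν] / σ k) := by
              ring
          _ ≤ _ := h4
          _ = _ := by ring
      exact ⟨fun k => by linarith [hstep k, h1 k], fun k hk => by linarith [hstep k, h2 k hk]⟩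
    exact gaussianReal_upperSet_inter_Ioc_le hc hv hp hδ hU
      ((by fun_prop : Measurable fun s : ℝ => (s, r)) (hΦ (hA j)))
  have hcover : {z : Fin p → ℝ | (∀ j, z j ≤ a j + δ) ∧ ∃ j, a j < z j} ⊆
      ⋃ j, E j ∩ {z | z j ∈ Set.Ioc (a j) (a j + δ)} := by
    rintro z ⟨h1, i, h2⟩
    have : Nonempty (Fin p) := ⟨i⟩
    obtain ⟨m, hm⟩ := Finite.exists_max fun k => (z k - a k) / σ k
    obtain ⟨j, hj, hjmin⟩ := WellFounded.has_min (wellFounded_lt (α := Fin p))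
      {j | ∀ k, (z k - a k) / σ k ≤ (z j - a j) / σ j} ⟨m, hm⟩
    refine Set.mem_iUnion.2 ⟨j, ⟨hj, fun k hk => ?_⟩, ?_, h1 j⟩
    · by_contra! hcon
      exact hjmin k (fun l => (hj l).trans hcon) hk
    · have h3 : 0 < (z j - a j) / σ j :=
        (div_pos (sub_pos.2 h2) (hσ i)).trans_le (hj i)
      have := (div_pos_iff_of_pos_right (hσ j)).1 h3
      linarith
  have hp' : (0 : ℝ) < p := by exact_mod_cast hp
  calc _ ≤ _ := measure_mono hcover
    _ ≤ ∑ j, ν (E j ∩ {z | z j ∈ Set.Ioc (a j) (a j + δ)}) := measure_iUnion_fintype_le _ _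
    _ ≤ ∑ j, (ENNReal.ofReal (δ / √c * K) * ν (E j) + ENNReal.ofReal (δ / √c / p)) :=
        Finset.sum_le_sum fun j _ => hcell j
    _ = ENNReal.ofReal (δ / √c * K) * ν (⋃ j, E j) + p * ENNReal.ofReal (δ / √c / p) := by
        rw [Finset.sum_add_distrib, ← Finset.mul_sum, measure_iUnion hdisj hE, tsum_fintype]
        simp
    _ ≤ ENNReal.ofReal (δ / √c * K) * 1 + p * ENNReal.ofReal (δ / √c / p) := by
        gcongr
        exact prob_le_one
    _ = _ := by
        rw [mul_one, ← ENNReal.ofReal_natCast p, ← ENNReal.ofReal_mul hp'.le,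
          ← ENNReal.ofReal_add (by positivity) (by positivity)]
        congr 1
        field_simp

section Calculus

variable {p : ℕ} {φ : (Fin p → ℝ) → ℝ}

lemma fderiv_apply_eq_sum_pderiv1 (φ : (Fin p → ℝ) → ℝ) (x w : Fin p → ℝ) :
    fderiv ℝ φ x w = ∑ j, w j * pderiv1 φ j x := by
  conv_lhs => rw [← Finset.univ_sum_single w, map_sum]
  refine Finset.sum_congr rfl fun j _ => ?_
  have : (Pi.single j (w j) : Fin p → ℝ) = w j • Pi.single j 1 := by
    rw [← Pi.single_smul]; simp
  rw [this, map_smul, smul_eq_mul, pderiv1]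

lemma ContDiff.pderiv1_continuous (hφ : ContDiff ℝ 1 φ) (j : Fin p) :
    Continuous (pderiv1 φ j) :=
  (hφ.continuous_fderiv one_ne_zero).clm_apply continuous_const

lemma ContDiff.pderiv1_contDiff (hφ : ContDiff ℝ 2 φ) (j : Fin p) :
    ContDiff ℝ 1 (pderiv1 φ j) :=
  (hφ.fderiv_right (m := 1) (by norm_num)).clm_apply contDiff_const

lemma ContDiff.pderiv2_continuous (hφ : ContDiff ℝ 2 φ) (j k : Fin p) :
    Continuous (pderiv2 φ j k) :=
  (hφ.pderiv1_contDiff j).pderiv1_continuous k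

lemma ContDiff.pderiv2_comm (hφ : ContDiff ℝ 2 φ) (j k : Fin p) (x : Fin p → ℝ) :
    pderiv2 φ j k x = pderiv2 φ k j x := by
  have hd : DifferentiableAt ℝ (fderiv ℝ φ) x :=
    (hφ.fderiv_right (m := 1) (by norm_num)).differentiable one_ne_zero x
  have key : ∀ j k, pderiv2 φ j k x = fderiv ℝ (fderiv ℝ φ) x (Pi.single k 1) (Pi.single j 1) := by
    intro j k
    unfold pderiv2 pderiv1
    rw [fderiv_clm_apply hd (differentiableAt_const _)]
    simp
  rw [key, key]
  exact (hφ.contDiffAt.isSymmSndFDerivAt (by simp)) _ _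

lemma hasDerivAt_comp_of_pderiv1 (hφ : Differentiable ℝ φ) {γ : ℝ → Fin p → ℝ}
    {γ' : Fin p → ℝ} {t : ℝ} (hγ : HasDerivAt γ γ' t) :
    HasDerivAt (fun s => φ (γ s)) (∑ j, γ' j * pderiv1 φ j (γ t)) t := by
  rw [← fderiv_apply_eq_sum_pderiv1]
  exact (hφ (γ t)).hasFDerivAt.comp_hasDerivAt t hγ

lemma pderiv1_comp_affine (hφ : Differentiable ℝ φ) (a : ℝ) (w : Fin p → ℝ) (j : Fin p) :
    pderiv1 (fun x => φ (a • x + w)) j = fun x => a * pderiv1 φ j (a • x + w) := by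
  ext x
  have h : HasFDerivAt (fun x : Fin p → ℝ => a • x + w)
      (a • ContinuousLinearMap.id ℝ (Fin p → ℝ)) x :=
    ((hasFDerivAt_id x).const_smul a).add_const w
  have := (hφ (a • x + w)).hasFDerivAt.comp x h
  unfold pderiv1
  rw [show (fun x => φ (a • x + w)) = φ ∘ fun x => a • x + w from rfl, this.fderiv]
  simp

lemma pderiv2_comp_affine (hφ : ContDiff ℝ 2 φ) (a : ℝ) (w : Fin p → ℝ) (j k : Fin p)
    (x : Fin p → ℝ) :
    pderiv2 (fun x => φ (a • x + w)) j k x = a ^ 2 * pderiv2 φ j k (a • x + w) := by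
  have hd := (hφ.pderiv1_contDiff j).differentiable one_ne_zero
  have e : pderiv1 (fun x => a * pderiv1 φ j (a • x + w)) k x =
      a * pderiv1 (fun x => pderiv1 φ j (a • x + w)) k x := by
    unfold pderiv1 at hd ⊢
    rw [fderiv_const_mul]
    · simp
    · fun_prop
  change pderiv1 (pderiv1 _ j) k x = _
  rw [pderiv1_comp_affine (hφ.differentiable two_ne_zero), e, pderiv1_comp_affine hd]
  change a * (a * pderiv2 φ j k (a • x + w)) = _
  ring

lemma MemCb2.comp_affine (hφ : MemCb2 φ) (a : ℝ) (w : Fin p → ℝ) :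
    MemCb2 (fun x => φ (a • x + w)) := by
  obtain ⟨h, M, hM⟩ := hφ
  have hM0 : 0 ≤ M := (abs_nonneg _).trans (hM 0).1
  refine ⟨h.comp (by fun_prop), (1 + |a| + |a| ^ 2) * M, fun x => ⟨?_, fun j => ?_, fun j k => ?_⟩⟩
  · have := (hM (a • x + w)).1
    nlinarith [mul_nonneg (abs_nonneg a) hM0, mul_nonneg (sq_nonneg |a|) hM0]
  · rw [pderiv1_comp_affine (h.differentiable two_ne_zero), abs_mul]
    have := mul_le_mul_of_nonneg_left ((hM (a • x + w)).2.1 j) (abs_nonneg a)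
    nlinarith [mul_nonneg (abs_nonneg a) hM0, mul_nonneg (sq_nonneg |a|) hM0]
  · rw [pderiv2_comp_affine h, abs_mul, abs_pow]
    have := mul_le_mul_of_nonneg_left ((hM (a • x + w)).2.2 j k) (sq_nonneg |a|)
    nlinarith [mul_nonneg (abs_nonneg a) hM0, mul_nonneg (sq_nonneg |a|) hM0]

end Calculus

/-- Gaussian integration by parts. -/
lemma integral_eval_mul_of_isGaussian {p : ℕ} (ν : Measure (Fin p → ℝ)) [IsGaussian ν]
    (hν : ∀ j, ∫ z, z j ∂ν = 0) (j : Fin p) (hj : Var[fun z => z j; ν] ≠ 0)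
    {f : (Fin p → ℝ) → ℝ} (hf : ContDiff ℝ 1 f) {M : ℝ} (hM : ∀ x, |f x| ≤ M)
    (hM' : ∀ k x, |pderiv1 f k x| ≤ M) :
    ∫ z, f z * z j ∂ν = ∑ k, cov[fun z => z j, fun z => z k; ν] * ∫ z, pderiv1 f k z ∂ν := by
  obtain ⟨ρ, hρ, hmap⟩ := exists_map_eq_map_prod_gaussianReal ν hν j hj
  set V := Var[fun z => z j; ν]
  have hV : 0 < V := lt_of_le_of_ne (variance_nonneg _ _) hj.symm
  set v := V.toNNReal
  have hv : v ≠ 0 := by simpa [v] using hV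
  have hvV : (v : ℝ) = V := Real.coe_toNNReal _ hV.le
  set C : Fin p → ℝ := fun k => cov[fun z => z j, fun z => z k; ν] with hC
  have hfc := hf.continuous
  have hgc := fun k => hf.pderiv1_continuous k
  have hid : HasGaussianLaw (id : (Fin p → ℝ) → (Fin p → ℝ)) ν := IsGaussian.hasGaussianLaw_id
  have hint : Integrable (fun z : Fin p → ℝ => z j) ν :=
    (hid.map_fun (ContinuousLinearMap.proj j)).integrable
  have hfint : Integrable (fun z => f z * z j) ν :=
    hint.bdd_mul (c := M) hfc.aestronglyMeasurable (.of_forall hM)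
  set Φ : ℝ × (Fin p → ℝ) → ℝ × (Fin p → ℝ) := fun q =>
    (q.1, fun k => q.1 * (C k / V) + q.2 k) with hΦdef
  have hΦ : Measurable Φ := by fun_prop
  have htrans : ∀ G : ℝ × (Fin p → ℝ) → ℝ, Continuous G →
      ∫ z, G (z j, z) ∂ν = ∫ q, G (Φ q) ∂((gaussianReal 0 v).prod ρ) := by
    intro G hG
    rw [← integral_map (φ := Φ) hΦ.aemeasurable hG.aestronglyMeasurable, ← hmap,
      integral_map (Measurable.aemeasurable (by fun_prop)) hG.aestronglyMeasurable]
  have hGint : Integrable (fun q => q.1 * f (Φ q).2) ((gaussianReal 0 v).prod ρ) := by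
    have hc : Continuous fun q : ℝ × (Fin p → ℝ) => q.1 * f q.2 := by fun_prop
    have h1 : Integrable (fun q : ℝ × (Fin p → ℝ) => q.1 * f q.2)
        (((gaussianReal 0 v).prod ρ).map Φ) := by
      rw [← hmap, integrable_map_measure hc.aestronglyMeasurable
        (Measurable.aemeasurable (by fun_prop))]
      simpa [Function.comp_def, mul_comm] using hfint
    exact h1.comp_measurable hΦ
  have h1D : ∀ r : Fin p → ℝ, ∫ s, s * f (Φ (s, r)).2 ∂gaussianReal 0 v =
      v * ∫ s, ∑ k, C k / V * pderiv1 f k (Φ (s, r)).2 ∂gaussianReal 0 v := by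
    intro r
    refine integral_id_mul_gaussianReal hv (M := (1 + ∑ k, |C k / V|) * M) (fun s => ?_) ?_
      (fun s => ?_) fun s => ?_
    · refine hasDerivAt_comp_of_pderiv1 (hf.differentiable one_ne_zero)
        (γ := fun s => (Φ (s, r)).2) ?_
      rw [hasDerivAt_pi]
      intro k
      simpa [Φ] using ((hasDerivAt_id s).mul_const (C k / V)).add_const (r k)
    · exact Continuous.measurable (by fun_prop)
    · have h0 : 0 ≤ M := (abs_nonneg _).trans (hM 0)
      have h2 : 0 ≤ ∑ k, |C k / V| := Finset.sum_nonneg fun _ _ => abs_nonneg _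
      nlinarith [hM (Φ (s, r)).2]
    · have h0 : 0 ≤ M := (abs_nonneg _).trans (hM 0)
      calc _ ≤ ∑ k, |C k / V * pderiv1 f k (Φ (s, r)).2| := Finset.abs_sum_le_sum_abs _ _
        _ ≤ ∑ k, |C k / V| * M := Finset.sum_le_sum fun k _ => by
            rw [abs_mul]
            exact mul_le_mul_of_nonneg_left (hM' k _) (abs_nonneg _)
        _ ≤ _ := by rw [← Finset.sum_mul]; nlinarith
  have hbint : ∀ k, Integrable (fun q => pderiv1 f k (Φ q).2) ((gaussianReal 0 v).prod ρ) :=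
    fun k => Integrable.of_bound (C := M)
      (((hgc k).measurable.comp (measurable_snd.comp hΦ)).aestronglyMeasurable)
      (.of_forall fun q => hM' k _)
  calc ∫ z, f z * z j ∂ν = ∫ q, q.1 * f (Φ q).2 ∂((gaussianReal 0 v).prod ρ) := by
        rw [← htrans (fun q => q.1 * f q.2) (by fun_prop)]
        simp only [mul_comm]
    _ = ∫ r, ∫ s, s * f (Φ (s, r)).2 ∂gaussianReal 0 v ∂ρ := integral_prod_symm _ hGint
    _ = ∫ r, v * ∫ s, ∑ k, C k / V * pderiv1 f k (Φ (s, r)).2 ∂gaussianReal 0 v ∂ρ := by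
        simp only [h1D]
    _ = v * ∫ q, ∑ k, C k / V * pderiv1 f k (Φ q).2 ∂((gaussianReal 0 v).prod ρ) := by
        rw [integral_const_mul, integral_prod_symm]
        exact integrable_finsetSum _ fun k _ => (hbint k).const_mul _
    _ = v * ∑ k, C k / V * ∫ q, pderiv1 f k (Φ q).2 ∂((gaussianReal 0 v).prod ρ) := by
        rw [integral_finsetSum _ fun k _ => (hbint k).const_mul _]
        simp only [integral_const_mul]
    _ = _ := by
        rw [Finset.mul_sum, hvV]
        refine Finset.sum_congr rfl fun k _ => ?_
        rw [htrans (fun q => pderiv1 f k q.2) (by fun_prop)]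
        rw [← mul_assoc, mul_div_cancel₀ _ hV.ne']

lemma isSteinKernel_of_isGaussian {p : ℕ} (ν : Measure (Fin p → ℝ)) [IsGaussian ν]
    (hν : ∀ j, ∫ z, z j ∂ν = 0) (hvar : ∀ j, Var[fun z => z j; ν] ≠ 0)
    {S : Fin p → Fin p → ℝ}
    (hS : ∀ j k, S j k + S k j = 2 * cov[fun z => z j, fun z => z k; ν]) :
    IsSteinKernel ν id (fun _ => S) := by
  rintro φ ⟨hφ, M, hM⟩
  simp only [id]
  have h1 : ∀ j, ∫ z, pderiv1 φ j z * z j ∂ν =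
      ∑ k, cov[fun z => z j, fun z => z k; ν] * ∫ z, pderiv2 φ j k z ∂ν := fun j =>
    integral_eval_mul_of_isGaussian ν hν j (hvar j) (hφ.pderiv1_contDiff j)
      (fun x => (hM x).2.1 j) (fun k x => (hM x).2.2 j k)
  simp only [h1, integral_mul_const]
  have hsymm : ∀ j k, ∫ z, pderiv2 φ j k z ∂ν = ∫ z, pderiv2 φ k j z ∂ν := fun j k => by
    simp only [hφ.pderiv2_comm j k]
  have h2 : ∑ j, ∑ k, (∫ z, pderiv2 φ j k z ∂ν) * S j k =
      ∑ j, ∑ k, (∫ z, pderiv2 φ j k z ∂ν) * S k j := by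
    rw [Finset.sum_comm]
    simp only [hsymm]
  have h3 : ∑ j, ∑ k, cov[fun z => z j, fun z => z k; ν] * ∫ z, pderiv2 φ j k z ∂ν =
      (∑ j, ∑ k, (∫ z, pderiv2 φ j k z ∂ν) * S j k +
        ∑ j, ∑ k, (∫ z, pderiv2 φ j k z ∂ν) * S k j) / 2 := by
    simp only [← Finset.sum_add_distrib, Finset.sum_div]
    refine Finset.sum_congr rfl fun j _ => Finset.sum_congr rfl fun k _ => ?_
    rw [← mul_add, hS]; ring
  rw [h3, ← h2]; ring

section Interpolation

variable {p : ℕ} {h : (Fin p → ℝ) → ℝ}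

lemma IsSteinKernel.comp_affine {μ : Measure (Fin p → ℝ)}
    {τ : (Fin p → ℝ) → Fin p → Fin p → ℝ} (hτ : IsSteinKernel μ id τ) (hh : MemCb2 h)
    {a : ℝ} (ha : a ≠ 0) (w : Fin p → ℝ) :
    ∑ j, ∫ v, pderiv1 h j (a • v + w) * v j ∂μ =
      a * ∑ j, ∑ k, ∫ v, pderiv2 h j k (a • v + w) * τ v j k ∂μ := by
  have := hτ _ (hh.comp_affine a w)
  simp only [pderiv1_comp_affine (hh.1.differentiable two_ne_zero), pderiv2_comp_affine hh.1,
    id, mul_assoc, integral_const_mul, ← Finset.mul_sum] at this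
  rw [pow_two, mul_assoc] at this
  exact mul_left_cancel₀ ha this

/-- The interpolation `θ ↦ E h(sin θ • V + cos θ • Z)` for independent `V` and `Z`. -/
lemma exists_integral_sub_integral_eq_of_isSteinKernel {μ ν : Measure (Fin p → ℝ)}
    [IsProbabilityMeasure μ] [IsProbabilityMeasure ν] (hμ : ∀ j, Integrable (fun v => v j) μ)
    (hν : ∀ j, Integrable (fun z => z j) ν)
    {τ : (Fin p → ℝ) → Fin p → Fin p → ℝ}
    (hτi : ∀ j k, Integrable (fun v => τ v j k) μ) (hτ : IsSteinKernel μ id τ)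
    {S : Fin p → Fin p → ℝ} (hS : IsSteinKernel ν id (fun _ => S)) (hh : MemCb2 h) :
    ∃ θ ∈ Set.Ioo 0 (Real.pi / 2), ∫ v, h v ∂μ - ∫ z, h z ∂ν =
      Real.pi / 2 * (Real.sin θ * Real.cos θ * ∫ v, ∫ z, ∑ j, ∑ k,
        pderiv2 h j k (Real.sin θ • v + Real.cos θ • z) * (τ v j k - S j k) ∂ν ∂μ) := by
  obtain ⟨hc, M, hM⟩ := id hh
  have hcont := hc.continuous
  have h1c := fun j => (hc.pderiv1_contDiff j).continuous
  have h2c := fun j k => hc.pderiv2_continuous j k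
  have hM0 : 0 ≤ M := (abs_nonneg _).trans (hM 0).1
  have hμ' : ∀ j, Integrable (fun q : (Fin p → ℝ) × (Fin p → ℝ) => q.1 j) (μ.prod ν) :=
    fun j => (hμ j).comp_fst ν
  have hν' : ∀ j, Integrable (fun q : (Fin p → ℝ) × (Fin p → ℝ) => q.2 j) (μ.prod ν) :=
    fun j => (hν j).comp_snd μ
  have hτ' : ∀ j k, Integrable (fun q : (Fin p → ℝ) × (Fin p → ℝ) => τ q.1 j k) (μ.prod ν) :=
    fun j k => (hτi j k).comp_fst ν
  set W : ℝ → (Fin p → ℝ) × (Fin p → ℝ) → Fin p → ℝ :=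
    fun θ q => Real.sin θ • q.1 + Real.cos θ • q.2 with hW
  have hWc : ∀ θ, Continuous (W θ) := fun θ => by fun_prop
  have hb1 : ∀ θ j {g : (Fin p → ℝ) × (Fin p → ℝ) → ℝ}, Integrable g (μ.prod ν) →
      Integrable (fun q => pderiv1 h j (W θ q) * g q) (μ.prod ν) := fun θ j g hg =>
    hg.bdd_mul (c := M) ((h1c j).comp (hWc θ)).aestronglyMeasurable
      (.of_forall fun q => (hM _).2.1 j)
  have hb2 : ∀ θ j k {g : (Fin p → ℝ) × (Fin p → ℝ) → ℝ}, Integrable g (μ.prod ν) →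
      Integrable (fun q => pderiv2 h j k (W θ q) * g q) (μ.prod ν) := fun θ j k g hg =>
    hg.bdd_mul (c := M) ((h2c j k).comp (hWc θ)).aestronglyMeasurable
      (.of_forall fun q => (hM _).2.2 j k)
  set D : ℝ → (Fin p → ℝ) × (Fin p → ℝ) → ℝ := fun θ q =>
    ∑ j, (Real.cos θ * q.1 j - Real.sin θ * q.2 j) * pderiv1 h j (W θ q) with hD
  have hderiv : ∀ θ, HasDerivAt (fun θ => ∫ q, h (W θ q) ∂(μ.prod ν))
      (∫ q, D θ q ∂(μ.prod ν)) θ := by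
    intro θ
    refine (hasDerivAt_integral_of_dominated_loc_of_deriv_le (μ := μ.prod ν)
      (F := fun θ q => h (W θ q)) (F' := D) (s := Set.univ)
      (bound := fun q => ∑ j, (|q.1 j| + |q.2 j|) * M) Filter.univ_mem
      (.of_forall fun θ => (hcont.comp (hWc θ)).aestronglyMeasurable)
      (Integrable.of_bound (C := M) (hcont.comp (hWc θ)).aestronglyMeasurable
        (.of_forall fun q => (hM _).1)) ?_ (.of_forall fun q θ _ => ?_) ?_
      (.of_forall fun q θ _ => ?_)).2
    · exact Continuous.aestronglyMeasurable (by fun_prop)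
    · refine (norm_sum_le _ _).trans (Finset.sum_le_sum fun j _ => ?_)
      rw [Real.norm_eq_abs, abs_mul]
      refine mul_le_mul ?_ ((hM _).2.1 j) (abs_nonneg _) (by positivity)
      refine (abs_sub _ _).trans ?_
      rw [abs_mul, abs_mul]
      exact add_le_add (mul_le_of_le_one_left (abs_nonneg _) (Real.abs_cos_le_one _))
        (mul_le_of_le_one_left (abs_nonneg _) (Real.abs_sin_le_one _))
    · exact integrable_finsetSum _ fun j _ => ((hμ' j).abs.add (hν' j).abs).mul_const _
    · refine hasDerivAt_comp_of_pderiv1 (hc.differentiable two_ne_zero) ?_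
      rw [hasDerivAt_pi]
      intro j
      have := ((Real.hasDerivAt_sin θ).mul_const (q.1 j)).fun_add
        ((Real.hasDerivAt_cos θ).mul_const (q.2 j))
      simpa [hW, sub_eq_add_neg] using this
  obtain ⟨θ, hθ, heq⟩ := exists_hasDerivAt_eq_slope _ _ (by positivity : (0 : ℝ) < Real.pi / 2)
    (fun θ _ => (hderiv θ).continuousAt.continuousWithinAt) fun θ _ => hderiv θ
  have hs : Real.sin θ ≠ 0 :=
    (Real.sin_pos_of_pos_of_lt_pi hθ.1 (by linarith [hθ.2, Real.pi_pos])).ne'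
  have hco : Real.cos θ ≠ 0 := (Real.cos_pos_of_mem_Ioo ⟨by linarith [hθ.1, Real.pi_pos], hθ.2⟩).ne'
  refine ⟨θ, hθ, ?_⟩
  have e1 : ∫ q, h (W (Real.pi / 2) q) ∂(μ.prod ν) = ∫ v, h v ∂μ := by
    simp only [hW, Real.sin_pi_div_two, Real.cos_pi_div_two, one_smul, zero_smul, add_zero]
    rw [integral_fun_fst (f := h)]; simp
  have e2 : ∫ q, h (W 0 q) ∂(μ.prod ν) = ∫ v, h v ∂ν := by
    simp only [hW, Real.sin_zero, Real.cos_zero, one_smul, zero_smul, zero_add]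
    rw [integral_fun_snd (f := h)]; simp
  rw [e1, e2, sub_zero, eq_div_iff (by positivity)] at heq
  rw [← heq, mul_comm]
  congr 1
  have hV : ∑ j, ∫ q, pderiv1 h j (W θ q) * q.1 j ∂(μ.prod ν) =
      Real.sin θ * ∑ j, ∑ k, ∫ q, pderiv2 h j k (W θ q) * τ q.1 j k ∂(μ.prod ν) := by
    have hi1 := fun j => hb1 θ j (hμ' j)
    have hi2 := fun j k => hb2 θ j k (hτ' j k)
    simp only [fun j => integral_prod_symm _ (hi1 j), fun j k => integral_prod_symm _ (hi2 j k)]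
    rw [← integral_finsetSum _ fun j _ => (hi1 j).integral_prod_right]
    simp only [← integral_finsetSum _ fun k _ => (hi2 _ k).integral_prod_right]
    rw [← integral_finsetSum _ fun j _ =>
      integrable_finsetSum _ fun k _ => (hi2 j k).integral_prod_right, ← integral_const_mul]
    refine integral_congr_ae (.of_forall fun z => ?_)
    exact hτ.comp_affine hh hs (Real.cos θ • z)
  have hZ : ∑ j, ∫ q, pderiv1 h j (W θ q) * q.2 j ∂(μ.prod ν) =
      Real.cos θ * ∑ j, ∑ k, ∫ q, pderiv2 h j k (W θ q) * S j k ∂(μ.prod ν) := by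
    have hi1 := fun j => hb1 θ j (hν' j)
    have hi2 := fun j k => hb2 θ j k (integrable_const (S j k))
    simp only [fun j => integral_prod _ (hi1 j), fun j k => integral_prod _ (hi2 j k)]
    rw [← integral_finsetSum _ fun j _ => (hi1 j).integral_prod_left]
    simp only [← integral_finsetSum _ fun k _ => (hi2 _ k).integral_prod_left]
    rw [← integral_finsetSum _ fun j _ =>
      integrable_finsetSum _ fun k _ => (hi2 j k).integral_prod_left, ← integral_const_mul]
    refine integral_congr_ae (.of_forall fun v => ?_)
    have := hS.comp_affine hh hco (Real.sin θ • v)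
    simpa only [hW, add_comm] using this
  have hi4 : ∀ j k, Integrable (fun q => pderiv2 h j k (W θ q) * (τ q.1 j k - S j k))
      (μ.prod ν) := fun j k => hb2 θ j k ((hτ' j k).sub (integrable_const (S j k)))
  have hi3 : Integrable (fun q => ∑ j, ∑ k, pderiv2 h j k (W θ q) * (τ q.1 j k - S j k))
      (μ.prod ν) := integrable_finsetSum _ fun j _ => integrable_finsetSum _ fun k _ => hi4 j k
  have e3 : ∫ v, ∫ z, ∑ j, ∑ k, pderiv2 h j k (Real.sin θ • v + Real.cos θ • z) *
      (τ v j k - S j k) ∂ν ∂μ = ∑ j, ∑ k, ∫ q, pderiv2 h j k (W θ q) * τ q.1 j k ∂(μ.prod ν) -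
        ∑ j, ∑ k, ∫ q, pderiv2 h j k (W θ q) * S j k ∂(μ.prod ν) := by
    rw [← integral_prod _ hi3, integral_finsetSum _ fun j _ => integrable_finsetSum _ fun k _ =>
      hi4 j k, ← Finset.sum_sub_distrib]
    refine Finset.sum_congr rfl fun j _ => ?_
    rw [integral_finsetSum _ fun k _ =>
      hi4 j k, ← Finset.sum_sub_distrib]
    refine Finset.sum_congr rfl fun k _ => ?_
    rw [← integral_sub (hb2 θ j k (hτ' j k)) (hb2 θ j k (integrable_const (S j k)))]
    simp only [mul_sub]
  have e4 : ∫ q, D θ q ∂(μ.prod ν) =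
      Real.cos θ * ∑ j, ∫ q, pderiv1 h j (W θ q) * q.1 j ∂(μ.prod ν) -
        Real.sin θ * ∑ j, ∫ q, pderiv1 h j (W θ q) * q.2 j ∂(μ.prod ν) := by
    have e5 : D θ = fun q => ∑ j, (Real.cos θ * (pderiv1 h j (W θ q) * q.1 j) -
        Real.sin θ * (pderiv1 h j (W θ q) * q.2 j)) := by
      ext q
      exact Finset.sum_congr rfl fun j _ => by ring
    have hi5 : ∀ j, Integrable (fun q => Real.cos θ * (pderiv1 h j (W θ q) * q.1 j) -
        Real.sin θ * (pderiv1 h j (W θ q) * q.2 j)) (μ.prod ν) := fun j =>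
      ((hb1 θ j (hμ' j)).const_mul _).sub ((hb1 θ j (hν' j)).const_mul _)
    rw [e5, integral_finsetSum _ fun j _ => hi5 j,
      Finset.mul_sum, Finset.mul_sum, ← Finset.sum_sub_distrib]
    refine Finset.sum_congr rfl fun j _ => ?_
    rw [integral_sub ((hb1 θ j (hμ' j)).const_mul _) ((hb1 θ j (hν' j)).const_mul _),
      integral_const_mul, integral_const_mul]
  rw [e3, e4, hV, hZ]
  ring

end Interpolation

lemma exists_smooth_step : ∃ M : ℝ, 0 < M ∧ ∃ g g' g'' : ℝ → ℝ, ContDiff ℝ 2 g ∧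
    (∀ t, HasDerivAt g (g' t) t) ∧ (∀ t, HasDerivAt g' (g'' t) t) ∧
    (∀ t, 0 ≤ g t ∧ g t ≤ 1 ∧ |g' t| ≤ M ∧ |g'' t| ≤ M) ∧ (∀ t ≤ 0, g t = 1) ∧
    (∀ t, 1 ≤ t → g t = 0) ∧ ∀ t ∉ Set.Icc (0 : ℝ) 1, g' t = 0 ∧ g'' t = 0 := by
  set g : ℝ → ℝ := fun t => 1 - Real.smoothTransition t with hg
  have hgc : ContDiff ℝ 2 g := contDiff_const.sub Real.smoothTransition.contDiff
  have hg1 : ContDiff ℝ 1 (deriv g) := (contDiff_succ_iff_deriv (n := 1)).1 hgc |>.2.2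
  have hg2 : Continuous (deriv (deriv g)) := hg1.continuous_deriv le_rfl
  have hleft : ∀ t ≤ 0, g t = 1 := fun t ht => by
    simp [hg, Real.smoothTransition.zero_of_nonpos ht]
  have hright : ∀ t, 1 ≤ t → g t = 0 := fun t ht => by
    simp [hg, Real.smoothTransition.one_of_one_le ht]
  have hloc : ∀ t ∉ Set.Icc (0 : ℝ) 1, ∃ a, g =ᶠ[nhds t] fun _ => a := by
    intro t ht
    rcases lt_or_ge t 0 with h | h
    · exact ⟨1, (eventually_lt_nhds h).mono fun s hs => hleft s hs.le⟩
    · have h1 : 1 < t := by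
        by_contra! h1
        exact ht ⟨h, h1⟩
      exact ⟨0, (eventually_gt_nhds h1).mono fun s hs => hright s hs.le⟩
  have hzero : ∀ t ∉ Set.Icc (0 : ℝ) 1, deriv g t = 0 ∧ deriv (deriv g) t = 0 := by
    intro t ht
    obtain ⟨a, ha⟩ := hloc t ht
    have h1 := ha.deriv
    have h2 := h1.deriv
    exact ⟨by simpa using h1.eq_of_nhds, by simpa using h2.eq_of_nhds⟩
  obtain ⟨M₁, hM₁⟩ := isCompact_Icc.exists_bound_of_continuousOn
    (s := Set.Icc (0 : ℝ) 1) hg1.continuous.continuousOn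
  obtain ⟨M₂, hM₂⟩ := isCompact_Icc.exists_bound_of_continuousOn
    (s := Set.Icc (0 : ℝ) 1) hg2.continuousOn
  have hM1 : 0 ≤ M₁ := (norm_nonneg _).trans (hM₁ 0 (by simp))
  have hM2 : 0 ≤ M₂ := (norm_nonneg _).trans (hM₂ 0 (by simp))
  refine ⟨M₁ + M₂ + 1, by positivity, g, deriv g, deriv (deriv g), hgc,
    fun t => (hgc.differentiable two_ne_zero t).hasDerivAt,
    fun t => (hg1.differentiable one_ne_zero t).hasDerivAt, fun t => ⟨?_, ?_, ?_, ?_⟩,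
    hleft, hright, hzero⟩
  · linarith [Real.smoothTransition.le_one t]
  · linarith [Real.smoothTransition.nonneg t]
  · by_cases ht : t ∈ Set.Icc (0 : ℝ) 1
    · linarith [hM₁ t ht, Real.norm_eq_abs (deriv g t)]
    · rw [(hzero t ht).1, abs_zero]; positivity
  · by_cases ht : t ∈ Set.Icc (0 : ℝ) 1
    · linarith [hM₂ t ht, Real.norm_eq_abs (deriv (deriv g) t)]
    · rw [(hzero t ht).2, abs_zero]; positivity

lemma pderiv1_eq_of_hasLineDerivAt {p : ℕ} {φ : (Fin p → ℝ) → ℝ} {x : Fin p → ℝ} {j : Fin p}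
    {d : ℝ} (hφ : DifferentiableAt ℝ φ x) (h : HasLineDerivAt ℝ φ d x (Pi.single j 1)) :
    pderiv1 φ j x = d := by
  rw [pderiv1, ← hφ.lineDeriv_eq_fderiv, h.lineDeriv]

/-- The log-sum-exp function with inverse temperature `β`, centered at `y`. -/
noncomputable def softMax {p : ℕ} (β : ℝ) (y x : Fin p → ℝ) : ℝ :=
  β⁻¹ * Real.log (∑ i, Real.exp (β * (x i - y i)))

/-- The softmax weights, i.e. the gradient of `softMax`. -/
noncomputable def softMaxWeight {p : ℕ} (β : ℝ) (y : Fin p → ℝ) (j : Fin p) (x : Fin p → ℝ) : ℝ :=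
  Real.exp (β * (x j - y j)) / ∑ i, Real.exp (β * (x i - y i))

section SoftMax

variable {p : ℕ} {β : ℝ} (y : Fin p → ℝ)

lemma sum_exp_pos (hp : 0 < p) (β : ℝ) (x : Fin p → ℝ) :
    0 < ∑ i, Real.exp (β * (x i - y i)) :=
  Finset.sum_pos (fun _ _ => Real.exp_pos _) ⟨⟨0, hp⟩, Finset.mem_univ _⟩

lemma contDiff_softMax (hp : 0 < p) : ContDiff ℝ 2 (softMax β y) := by
  unfold softMax
  exact contDiff_const.mul (ContDiff.log (by fun_prop) fun x => (sum_exp_pos y hp β x).ne')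

lemma softMaxWeight_nonneg (j : Fin p) (x : Fin p → ℝ) : 0 ≤ softMaxWeight β y j x := by
  unfold softMaxWeight; positivity

lemma sum_softMaxWeight (hp : 0 < p) (x : Fin p → ℝ) : ∑ j, softMaxWeight β y j x = 1 := by
  unfold softMaxWeight
  rw [← Finset.sum_div, div_self (sum_exp_pos y hp β x).ne']

lemma hasDerivAt_sum_exp_line (x : Fin p → ℝ) (j : Fin p) :
    HasDerivAt (fun t : ℝ => ∑ i, Real.exp (β * ((x + t • Pi.single j 1 : Fin p → ℝ) i - y i)))
      (β * Real.exp (β * (x j - y j))) 0 := by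
  have : ∀ i ∈ Finset.univ, HasDerivAt
      (fun t : ℝ => Real.exp (β * ((x + t • Pi.single j 1 : Fin p → ℝ) i - y i)))
      (Real.exp (β * (x i - y i)) * (β * Pi.single (M := fun _ => ℝ) j 1 i)) 0 := fun i _ => by
    have := (((((hasDerivAt_id (0 : ℝ)).mul_const
      (Pi.single (M := fun _ => ℝ) j 1 i)).const_add (x i)).sub_const (y i)).const_mul β).exp
    simpa using this
  refine (HasDerivAt.fun_sum this).congr_deriv ?_
  rw [Finset.sum_eq_single j (fun i _ hij => by simp [hij]) (by simp)]
  simp [mul_comm]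

lemma hasLineDerivAt_softMax (hp : 0 < p) (hβ : β ≠ 0) (x : Fin p → ℝ) (j : Fin p) :
    HasLineDerivAt ℝ (softMax β y) (softMaxWeight β y j x) x (Pi.single j 1) := by
  have := ((hasDerivAt_sum_exp_line y x j (β := β)).log
    (by simpa using (sum_exp_pos y hp β x).ne')).const_mul β⁻¹
  refine HasDerivAt.congr_deriv this ?_
  simp only [softMaxWeight, zero_smul, add_zero]
  field_simp

lemma hasLineDerivAt_softMaxWeight (hp : 0 < p) (x : Fin p → ℝ) (j k : Fin p) :
    HasLineDerivAt ℝ (softMaxWeight β y j) (β * (softMaxWeight β y j x *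
      (if j = k then 1 else 0) - softMaxWeight β y j x * softMaxWeight β y k x)) x
      (Pi.single k 1) := by
  have hN := (sum_exp_pos y hp β x).ne'
  have h1 : HasDerivAt (fun t : ℝ => Real.exp (β * ((x + t • Pi.single k 1 : Fin p → ℝ) j - y j)))
      (Real.exp (β * (x j - y j)) * (β * if j = k then 1 else 0)) 0 := by
    have := (((((hasDerivAt_id (0 : ℝ)).mul_const
      (Pi.single (M := fun _ => ℝ) k 1 j)).const_add (x j)).sub_const (y j)).const_mul β).exp
    simpa [Pi.single_apply] using this
  have := h1.fun_div (hasDerivAt_sum_exp_line y x k (β := β)) (by simpa using hN)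
  refine HasDerivAt.congr_deriv this ?_
  unfold softMaxWeight
  simp only [zero_smul, add_zero]
  field_simp

lemma le_softMax (hp : 0 < p) (hβ : 0 < β) (x : Fin p → ℝ) (j : Fin p) :
    x j - y j ≤ softMax β y x := by
  have h : Real.exp (β * (x j - y j)) ≤ ∑ i, Real.exp (β * (x i - y i)) :=
    Finset.single_le_sum (fun i _ => (Real.exp_pos (β * (x i - y i))).le) (Finset.mem_univ j)
  have := (Real.le_log_iff_exp_le (sum_exp_pos y hp β x)).2 h
  rw [softMax, inv_mul_eq_div, le_div_iff₀ hβ]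
  linarith

lemma softMax_le (hp : 0 < p) (hβ : 0 < β) {x : Fin p → ℝ} {m : ℝ} (h : ∀ j, x j - y j ≤ m) :
    softMax β y x ≤ m + Real.log p / β := by
  have hp' : (0 : ℝ) < p := by exact_mod_cast hp
  have h1 : ∑ i, Real.exp (β * (x i - y i)) ≤ p * Real.exp (β * m) := by
    calc _ ≤ ∑ _i : Fin p, Real.exp (β * m) := Finset.sum_le_sum fun i _ =>
          Real.exp_le_exp.2 (mul_le_mul_of_nonneg_left (h i) hβ.le)
      _ = _ := by simp
  have h2 := Real.log_le_log (sum_exp_pos y hp β x) h1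
  rw [Real.log_mul hp'.ne' (Real.exp_pos _).ne', Real.log_exp] at h2
  rw [softMax, inv_mul_eq_div, div_le_iff₀ hβ, add_mul, div_mul_cancel₀ _ hβ.ne']
  linarith

end SoftMax

lemma one_half_le_log_natCast {p : ℕ} (hp : 2 ≤ p) : 1 / 2 ≤ Real.log p := by
  have h2 : Real.log 2 ≤ Real.log p := Real.log_le_log (by norm_num) (by exact_mod_cast hp)
  linarith [Real.log_two_gt_d9]

/-- A smooth approximation of the indicator of the orthant `{x | x ≤ y}`. -/
lemma exists_smooth_orthant_indicator : ∃ M : ℝ, 0 < M ∧ ∀ (p : ℕ), 2 ≤ p →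
    ∀ (ε : ℝ), 0 < ε → ∀ y : Fin p → ℝ, ∃ h : (Fin p → ℝ) → ℝ, MemCb2 h ∧
      (∀ x, 0 ≤ h x ∧ h x ≤ 1) ∧ (∀ x, (∀ j, x j ≤ y j - ε) → h x = 1) ∧
      (∀ x, (∃ j, y j + ε < x j) → h x = 0) ∧
      (∀ x, ∑ j, ∑ k, |pderiv2 h j k x| ≤ M * (Real.log p / ε ^ 2)) ∧
      ∀ x j k, pderiv2 h j k x ≠ 0 → (∀ i, x i ≤ y i + ε) ∧ ∃ i, y i - 2 * ε < x i := by
  obtain ⟨M, hM, g, g', g'', hg, hg1, hg2, hgb, hleft, hright, hzero⟩ := exists_smooth_step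
  refine ⟨4 * M, by positivity, fun p hp ε hε y => ?_⟩
  have hp0 : 0 < p := by omega
  have hlog := one_half_le_log_natCast hp
  set β := Real.log p / ε with hβdef
  have hβ : 0 < β := by positivity
  have hlogβ : Real.log p / β = ε := by rw [hβdef]; field_simp
  set F := softMax β y with hF
  set w := softMaxWeight β y with hw
  have hFc : ContDiff ℝ 2 F := contDiff_softMax y hp0
  set h : (Fin p → ℝ) → ℝ := fun x => g (F x / ε) with hh
  have hhc : ContDiff ℝ 2 h := hg.comp (hFc.div_const ε)
  have hG : ∀ (G : ℝ → ℝ) (G' : ℝ) x j, HasDerivAt G G' (F x / ε) →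
      HasLineDerivAt ℝ (fun x => G (F x / ε)) (G' * (w j x / ε)) x (Pi.single j 1) := by
    intro G G' x j hG
    have h1 : HasDerivAt (fun t : ℝ => F (x + t • Pi.single j 1) / ε) (w j x / ε) 0 :=
      (hasLineDerivAt_softMax y hp0 hβ.ne' x j).div_const ε
    exact HasDerivAt.comp (h₂ := G) (h := fun t : ℝ => F (x + t • Pi.single j 1) / ε) 0
      (by simpa using hG) h1
  have hd1 : ∀ j, pderiv1 h j = fun x => g' (F x / ε) * (w j x / ε) := fun j => by
    ext x
    exact pderiv1_eq_of_hasLineDerivAt (hhc.differentiable two_ne_zero x) (hG g _ x j (hg1 _))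
  have hd2 : ∀ j k x, pderiv2 h j k x = g'' (F x / ε) / ε ^ 2 * (w j x * w k x) +
      g' (F x / ε) / ε * (β * (w j x * (if j = k then 1 else 0) - w j x * w k x)) := by
    intro j k x
    have hdiff := (hhc.pderiv1_contDiff j).differentiable one_ne_zero x
    refine pderiv1_eq_of_hasLineDerivAt (φ := pderiv1 h j) hdiff ?_
    rw [hd1]
    have h1 := (hG g' _ x k (hg2 _))
    have h2 : HasDerivAt _ _ _ := (hasLineDerivAt_softMaxWeight (β := β) y hp0 x j k).div_const ε
    have h3 := HasDerivAt.fun_mul h1 h2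
    refine HasDerivAt.congr_deriv h3 ?_
    simp only [zero_smul, add_zero]
    field_simp
    ring
  have hw0 : ∀ j x, 0 ≤ w j x := fun j x => softMaxWeight_nonneg y j x
  have hw1 : ∀ x, ∑ j, w j x = 1 := fun x => sum_softMaxWeight y hp0 x
  have hwle : ∀ j x, w j x ≤ 1 := fun j x => by
    rw [← hw1 x]
    exact Finset.single_le_sum (fun i _ => hw0 i x) (Finset.mem_univ j)
  have hbound : ∀ x, ∑ j, ∑ k, |pderiv2 h j k x| ≤ 4 * M * (Real.log p / ε ^ 2) := by
    intro x
    have h1 : ∀ j k, |pderiv2 h j k x| ≤ M / ε ^ 2 * (w j x * w k x) +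
        M / ε * (β * (w j x * (if j = k then 1 else 0) + w j x * w k x)) := by
      intro j k
      have hwjk := mul_nonneg (hw0 j x) (hw0 k x)
      have hδ : (0 : ℝ) ≤ w j x * (if j = k then 1 else 0) := by
        split_ifs <;> simp [hw0]
      rw [hd2]
      refine (abs_add_le _ _).trans (add_le_add ?_ ?_)
      · rw [abs_mul, abs_div, abs_of_nonneg hwjk, abs_of_nonneg (sq_nonneg ε)]
        gcongr
        exact (hgb _).2.2.2
      · rw [abs_mul, abs_div, abs_mul, abs_of_pos hε, abs_of_pos hβ]
        gcongr
        · exact (hgb _).2.2.1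
        · refine (abs_sub _ _).trans ?_
          rw [abs_of_nonneg hδ, abs_of_nonneg hwjk]
    calc _ ≤ ∑ j, ∑ k, (M / ε ^ 2 * (w j x * w k x) +
          M / ε * (β * (w j x * (if j = k then 1 else 0) + w j x * w k x))) :=
          Finset.sum_le_sum fun j _ => Finset.sum_le_sum fun k _ => h1 j k
      _ = M / ε ^ 2 + M / ε * (β * 2) := by
          simp only [Finset.sum_add_distrib, ← Finset.mul_sum, mul_add, hw1, mul_one,
            Finset.sum_ite_eq, Finset.mem_univ, if_true]
          ring
      _ = M / ε ^ 2 * (1 + 2 * Real.log p) := by rw [hβdef]; field_simp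
      _ ≤ M / ε ^ 2 * (4 * Real.log p) := by gcongr; linarith
      _ = _ := by ring
  refine ⟨h, ⟨hhc, 1 + M / ε + 4 * M * (Real.log p / ε ^ 2), fun x => ⟨?_, fun j => ?_,
    fun j k => ?_⟩⟩, fun x => ⟨(hgb _).1, (hgb _).2.1⟩, fun x hx => hleft _ ?_,
    fun x hx => hright _ ?_, hbound, fun x j k hne => ?_⟩
  · rw [abs_of_nonneg (hgb _).1]
    have : 0 ≤ M / ε + 4 * M * (Real.log p / ε ^ 2) := by positivity
    linarith [(hgb (F x / ε)).2.1]
  · have h0 : 0 ≤ 1 + 4 * M * (Real.log p / ε ^ 2) := by positivity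
    have h1 : |pderiv1 h j x| ≤ M / ε := by
      rw [hd1, abs_mul, abs_div, abs_of_pos hε, abs_of_nonneg (hw0 j x), ← mul_div_assoc]
      gcongr
      calc _ ≤ M * 1 := mul_le_mul (hgb _).2.2.1 (hwle j x) (hw0 j x) hM.le
        _ = M := mul_one M
    linarith
  · have h0 : 0 ≤ 1 + M / ε := by positivity
    have h1 : |pderiv2 h j k x| ≤ ∑ j, ∑ k, |pderiv2 h j k x| :=
      (Finset.single_le_sum (f := fun k => |pderiv2 h j k x|) (fun k _ => abs_nonneg _)
        (Finset.mem_univ k)).trans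
        (Finset.single_le_sum (f := fun j => ∑ k, |pderiv2 h j k x|)
          (fun j _ => Finset.sum_nonneg fun k _ => abs_nonneg _) (Finset.mem_univ j))
    linarith [hbound x]
  · refine div_nonpos_of_nonpos_of_nonneg ?_ hε.le
    have := softMax_le y hp0 hβ (x := x) (m := -ε) fun j => by linarith [hx j]
    rw [hlogβ] at this
    linarith
  · obtain ⟨j, hj⟩ := hx
    rw [le_div_iff₀ hε]
    linarith [le_softMax y hp0 hβ x j]
  · have hmem : F x / ε ∈ Set.Icc (0 : ℝ) 1 := by
      by_contra hcon
      exact hne (by rw [hd2, (hzero _ hcon).1, (hzero _ hcon).2]; simp)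
    have hle : F x ≤ ε := by simpa using (div_le_iff₀ hε).1 hmem.2
    have hge : 0 ≤ F x := by simpa using (le_div_iff₀ hε).1 hmem.1
    refine ⟨fun i => by linarith [le_softMax y hp0 hβ x i], ?_⟩
    by_contra! hcon
    have := softMax_le y hp0 hβ (x := x) (m := -(2 * ε)) fun j => by linarith [hcon j]
    rw [hlogβ] at this
    linarith

lemma exists_gaussian_orthant_shell_le {c : ℝ} (hc : 0 < c) : ∃ K : ℝ, 0 < K ∧
    ∀ (p : ℕ), 2 ≤ p → ∀ (ν : Measure (Fin p → ℝ)) (_ : IsGaussian ν),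
      (∀ j, ∫ z, z j ∂ν = 0) → (∀ j, c ≤ Var[fun z => z j; ν]) →
      ∀ (a : Fin p → ℝ) (δ : ℝ), 0 ≤ δ →
        ν.real {z | (∀ j, z j ≤ a j + δ) ∧ ∃ j, a j < z j} ≤ K * δ * √(Real.log p) := by
  refine ⟨(Real.exp (3 / 2) * (√2 + 2) + 2) / √c, by positivity,
    fun p hp ν _ hν hvar a δ hδ => ?_⟩
  have hlog := one_half_le_log_natCast hp
  have h := gaussian_orthant_shell_le hc (by omega) ν hν hvar a hδ
  have hL : 1 / 2 ≤ √(Real.log p) := Real.le_sqrt_of_sq_le (by norm_num; linarith)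
  refine (ENNReal.toReal_mono ENNReal.ofReal_ne_top h).trans ?_
  rw [ENNReal.toReal_ofReal (by positivity), Real.sqrt_mul zero_le_two]
  have he := Real.exp_pos (3 / 2)
  calc _ ≤ δ / √c * (Real.exp (3 / 2) * (√2 * √(Real.log p) + 2 * √(Real.log p)) +
        2 * √(Real.log p)) := by gcongr <;> linarith
    _ = _ := by ring

lemma measureReal_Iic_le_integral_le {p : ℕ} (ρ : Measure (Fin p → ℝ)) [IsProbabilityMeasure ρ]
    {h : (Fin p → ℝ) → ℝ} (hc : Continuous h) (h01 : ∀ x, 0 ≤ h x ∧ h x ≤ 1)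
    {y₁ y₂ : Fin p → ℝ} (h1 : ∀ x, (∀ j, x j ≤ y₁ j) → h x = 1)
    (h0 : ∀ x, (∃ j, y₂ j < x j) → h x = 0) :
    ρ.real (Set.Iic y₁) ≤ ∫ x, h x ∂ρ ∧ ∫ x, h x ∂ρ ≤ ρ.real (Set.Iic y₂) := by
  have hi : Integrable h ρ := Integrable.of_bound (C := 1) hc.aestronglyMeasurable
    (.of_forall fun x => by rw [Real.norm_eq_abs, abs_of_nonneg (h01 x).1]; exact (h01 x).2)
  have hind : ∀ y : Fin p → ℝ, Integrable (Set.indicator (Set.Iic y) (1 : (Fin p → ℝ) → ℝ)) ρ :=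
    fun y => (integrable_const (1 : ℝ)).indicator measurableSet_Iic
  rw [← integral_indicator_one measurableSet_Iic, ← integral_indicator_one measurableSet_Iic]
  refine ⟨integral_mono (hind _) hi fun x => ?_, integral_mono hi (hind _) fun x => ?_⟩
  · by_cases hx : x ∈ Set.Iic y₁
    · simp [Set.indicator_of_mem hx, h1 x hx]
    · simp [Set.indicator_of_notMem hx, (h01 x).1]
  · by_cases hx : x ∈ Set.Iic y₂
    · simp [Set.indicator_of_mem hx, (h01 x).2]
    · have : ∃ j, y₂ j < x j := by
        by_contra! hcon
        exact hx hcon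
      simp [Set.indicator_of_notMem hx, h0 x this]

lemma exists_abs_integral_sub_integral_le {c : ℝ} (hc : 0 < c) : ∃ K : ℝ, 0 < K ∧
    ∀ (p : ℕ), 2 ≤ p → ∀ (μ ν : Measure (Fin p → ℝ)) (_ : IsProbabilityMeasure μ)
      (_ : IsGaussian ν), (∀ j, Integrable (fun v => v j) μ) →
      (∀ j, ∫ z, z j ∂ν = 0) → (∀ j, c ≤ Var[fun z => z j; ν]) →
      ∀ (τ : (Fin p → ℝ) → Fin p → Fin p → ℝ) (S : Fin p → Fin p → ℝ),
      (∀ j k, Integrable (fun v => τ v j k) μ) → IsSteinKernel μ id τ →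
      IsSteinKernel ν id (fun _ => S) →
      ∀ D : (Fin p → ℝ) → ℝ, Integrable D μ → (∀ v j k, |τ v j k - S j k| ≤ D v) →
      ∀ ε : ℝ, 0 < ε → (∫ v, D v ∂μ) * Real.log p ≤ ε ^ 2 →
      ∀ y : Fin p → ℝ, ∃ h : (Fin p → ℝ) → ℝ, Continuous h ∧
        (∀ x, 0 ≤ h x ∧ h x ≤ 1) ∧ (∀ x, (∀ j, x j ≤ y j - ε) → h x = 1) ∧
        (∀ x, (∃ j, y j + ε < x j) → h x = 0) ∧
        |∫ v, h v ∂μ - ∫ z, h z ∂ν| ≤ K * ε * √(Real.log p) := by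
  obtain ⟨K, hK, hshell⟩ := exists_gaussian_orthant_shell_le hc
  obtain ⟨M, hM, hsmooth⟩ := exists_smooth_orthant_indicator
  refine ⟨Real.pi / 2 * (M * (3 * K)), by positivity, ?_⟩
  intro p hp μ ν _ _ hμ hν hvar τ S hτi hτ hS D hDi hD ε hε hΔ y
  obtain ⟨h, hh, h01, h1, h0, hsum, hsupp⟩ := hsmooth p hp ε hε y
  refine ⟨h, hh.1.continuous, h01, h1, h0, ?_⟩
  have hlog := one_half_le_log_natCast hp
  have hid : HasGaussianLaw (id : (Fin p → ℝ) → (Fin p → ℝ)) ν := IsGaussian.hasGaussianLaw_id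
  have hνi : ∀ j, Integrable (fun z : Fin p → ℝ => z j) ν := fun j =>
    (hid.map_fun (ContinuousLinearMap.proj j)).integrable
  obtain ⟨θ, hθ, heq⟩ :=
    exists_integral_sub_integral_eq_of_isSteinKernel hμ hνi hτi hτ hS hh
  have hs : 0 < Real.sin θ :=
    Real.sin_pos_of_pos_of_lt_pi hθ.1 (by linarith [hθ.2, Real.pi_pos])
  have hco : 0 < Real.cos θ :=
    Real.cos_pos_of_mem_Ioo ⟨by linarith [hθ.1, Real.pi_pos], hθ.2⟩
  set B := M * (Real.log p / ε ^ 2) with hB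
  have hB0 : 0 ≤ B := by positivity
  have hD0 : ∀ v, 0 ≤ D v := fun v => (abs_nonneg _).trans (hD v ⟨0, by omega⟩ ⟨0, by omega⟩)
  have hinner : ∀ v, ‖∫ z, ∑ j, ∑ k, pderiv2 h j k (Real.sin θ • v + Real.cos θ • z) *
      (τ v j k - S j k) ∂ν‖ ≤ B * (K * (3 * ε / Real.cos θ) * √(Real.log p)) * D v := by
    intro v
    set a : Fin p → ℝ := fun j => (y j - 2 * ε - Real.sin θ * v j) / Real.cos θ with ha
    set A : Set (Fin p → ℝ) :=
      {z | (∀ j, z j ≤ a j + 3 * ε / Real.cos θ) ∧ ∃ j, a j < z j} with hA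
    have hAm : MeasurableSet A := by
      simp only [hA, Set.ofPred_and, Set.ofPred_forall, Set.ofPred_exists]
      exact (MeasurableSet.iInter fun j => measurableSet_le (by fun_prop) (by fun_prop)).inter
        (MeasurableSet.iUnion fun j => measurableSet_lt (by fun_prop) (by fun_prop))
    have hpt : ∀ z, ‖∑ j, ∑ k, pderiv2 h j k (Real.sin θ • v + Real.cos θ • z) *
        (τ v j k - S j k)‖ ≤ A.indicator (fun _ => B * D v) z := by
      intro z
      by_cases hz : z ∈ A
      · rw [Set.indicator_of_mem hz]
        calc _ ≤ ∑ j, ∑ k, |pderiv2 h j k (Real.sin θ • v + Real.cos θ • z)| * D v := by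
              refine (norm_sum_le _ _).trans (Finset.sum_le_sum fun j _ =>
                (norm_sum_le _ _).trans (Finset.sum_le_sum fun k _ => ?_))
              rw [norm_mul, Real.norm_eq_abs, Real.norm_eq_abs]
              exact mul_le_mul_of_nonneg_left (hD v j k) (abs_nonneg _)
          _ ≤ _ := by
              simp only [← Finset.sum_mul]
              exact mul_le_mul_of_nonneg_right (hsum _) (hD0 v)
      · rw [Set.indicator_of_notMem hz]
        have hz0 : ∀ j k, pderiv2 h j k (Real.sin θ • v + Real.cos θ • z) = 0 := by
          intro j k
          by_contra hne
          obtain ⟨hup, i, hlo⟩ := hsupp _ j k hne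
          simp only [Pi.add_apply, Pi.smul_apply, smul_eq_mul] at hup hlo
          refine hz ⟨fun i => ?_, i, ?_⟩
          · rw [ha, ← add_div, le_div_iff₀ hco]
            linarith [hup i]
          · rw [ha, div_lt_iff₀ hco]
            linarith
        simp [hz0]
    refine (norm_integral_le_of_norm_le ((integrable_const _).indicator hAm)
      (.of_forall hpt)).trans ?_
    rw [integral_indicator_const _ hAm, smul_eq_mul]
    have := hshell p hp ν ‹_› hν hvar a (3 * ε / Real.cos θ) (by positivity)
    calc _ ≤ K * (3 * ε / Real.cos θ) * √(Real.log p) * (B * D v) :=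
          mul_le_mul_of_nonneg_right this (mul_nonneg hB0 (hD0 v))
      _ = _ := by ring
  have houter := norm_integral_le_of_norm_le (hDi.const_mul
    (B * (K * (3 * ε / Real.cos θ) * √(Real.log p)))) (.of_forall hinner)
  rw [integral_const_mul, Real.norm_eq_abs] at houter
  rw [heq, abs_mul, abs_mul, abs_mul, abs_of_pos hs, abs_of_pos hco, abs_of_pos (by positivity)]
  have hΔ' : (∫ v, D v ∂μ) * Real.log p / ε ≤ ε := by
    rw [div_le_iff₀ hε]; linarith
  calc _ ≤ Real.pi / 2 * (1 * Real.cos θ *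
        (B * (K * (3 * ε / Real.cos θ) * √(Real.log p)) * ∫ v, D v ∂μ)) := by
        gcongr
        exact Real.sin_le_one θ
    _ = Real.pi / 2 * (M * (3 * K)) * ((∫ v, D v ∂μ) * Real.log p / ε) * √(Real.log p) := by
        rw [hB]; field_simp
    _ ≤ _ := by gcongr

lemma exists_abs_measureReal_Iic_sub_le {c : ℝ} (hc : 0 < c) : ∃ K : ℝ, 0 < K ∧
    ∀ (p : ℕ), 2 ≤ p → ∀ (μ ν : Measure (Fin p → ℝ)) (_ : IsProbabilityMeasure μ)
      (_ : IsGaussian ν), (∀ j, Integrable (fun v => v j) μ) →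
      (∀ j, ∫ z, z j ∂ν = 0) → (∀ j, c ≤ Var[fun z => z j; ν]) →
      ∀ (τ : (Fin p → ℝ) → Fin p → Fin p → ℝ) (S : Fin p → Fin p → ℝ),
      (∀ j k, Integrable (fun v => τ v j k) μ) → IsSteinKernel μ id τ →
      IsSteinKernel ν id (fun _ => S) →
      ∀ D : (Fin p → ℝ) → ℝ, Integrable D μ → (∀ v j k, |τ v j k - S j k| ≤ D v) →
      ∀ y : Fin p → ℝ, |μ.real (Set.Iic y) - ν.real (Set.Iic y)| ≤
        K * ((∫ v, D v ∂μ) * Real.log p ^ 2) ^ ((1 : ℝ) / 2) := by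
  obtain ⟨K₁, hK₁, hshell⟩ := exists_gaussian_orthant_shell_le hc
  obtain ⟨K₂, hK₂, hcomp⟩ := exists_abs_integral_sub_integral_le hc
  refine ⟨K₂ + 2 * K₁, by positivity, ?_⟩
  intro p hp μ ν hμp hνg hμ hν hvar τ S hτi hτ hS D hDi hD y
  have hlog := one_half_le_log_natCast hp
  have hD0 : ∀ v, 0 ≤ D v := fun v => (abs_nonneg _).trans (hD v ⟨0, by omega⟩ ⟨0, by omega⟩)
  set Δ := ∫ v, D v ∂μ with hΔdef
  have hΔ0 : 0 ≤ Δ := integral_nonneg hD0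
  have hL : 0 < √(Real.log p) := Real.sqrt_pos.2 (by linarith)
  have hIic : ∀ (a : Fin p → ℝ) (δ : ℝ), 0 ≤ δ → ν.real (Set.Iic fun j => a j + δ) ≤
      ν.real (Set.Iic a) + K₁ * δ * √(Real.log p) := by
    intro a δ hδ
    refine le_trans ?_ (add_le_add_right (hshell p hp ν hνg hν hvar a δ hδ) _)
    refine (measureReal_mono fun z hz => ?_).trans (measureReal_union_le _ _)
    by_cases hza : z ∈ Set.Iic a
    · exact .inl hza
    · refine .inr ⟨hz, ?_⟩
      by_contra! hcon
      exact hza hcon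
  have key : ∀ ε : ℝ, 0 < ε → Δ * Real.log p ≤ ε ^ 2 →
      |μ.real (Set.Iic y) - ν.real (Set.Iic y)| ≤ (K₂ + 2 * K₁) * ε * √(Real.log p) := by
    intro ε hε hle
    have hmain := hcomp p hp μ ν hμp hνg hμ hν hvar τ S hτi hτ hS D hDi hD ε hε hle
    rw [abs_le]
    constructor
    · obtain ⟨h, hcont, h01, h1, h0, habs⟩ := hmain fun j => y j - ε
      have hν1 := (measureReal_Iic_le_integral_le ν hcont h01 h1 h0).1
      have hμ2 := (measureReal_Iic_le_integral_le μ hcont h01 h1 h0).2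
      have := hIic (fun j => y j - ε - ε) (2 * ε) (by positivity)
      simp only [show ∀ j, y j - ε - ε + 2 * ε = y j from fun j => by ring] at this
      simp only [sub_add_cancel] at hμ2
      linarith [(abs_le.1 habs).1]
    · obtain ⟨h, hcont, h01, h1, h0, habs⟩ := hmain fun j => y j + ε
      have hμ1 := (measureReal_Iic_le_integral_le μ hcont h01 h1 h0).1
      have hν2 := (measureReal_Iic_le_integral_le ν hcont h01 h1 h0).2
      have := hIic y (2 * ε) (by positivity)
      simp only [show ∀ j, y j + ε + ε = y j + 2 * ε from fun j => by ring] at hν2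
      simp only [add_sub_cancel_right] at hμ1
      linarith [(abs_le.1 habs).2]
  have hpow : (Δ * Real.log p ^ 2) ^ ((1 : ℝ) / 2) = √(Δ * Real.log p) * √(Real.log p) := by
    rw [← Real.sqrt_eq_rpow, ← Real.sqrt_mul (by positivity), pow_two, mul_assoc]
  rw [hpow, ← mul_assoc]
  refine le_of_forall_pos_le_add fun η hη => ?_
  have hpos : 0 < (K₂ + 2 * K₁) * √(Real.log p) := by positivity
  have hs := Real.sqrt_nonneg (Δ * Real.log p)
  have hη' : 0 < η / ((K₂ + 2 * K₁) * √(Real.log p)) := by positivity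
  refine (key (√(Δ * Real.log p) + η / ((K₂ + 2 * K₁) * √(Real.log p))) (by positivity) ?_).trans
    (le_of_eq ?_)
  · have := Real.sq_sqrt (show 0 ≤ Δ * Real.log p by positivity)
    nlinarith
  · field_simp

section CenteredGaussian

variable {Ω : Type} [MeasurableSpace Ω] {P : Measure Ω} {p : ℕ} {G : Ω → Fin p → ℝ}
  {S : Fin p → Fin p → ℝ}

lemma IsCenteredGaussianVec.map_sum_mul (h : IsCenteredGaussianVec P G S) (hG : Measurable G)
    (u : Fin p → ℝ) : (P.map G).map (fun z => ∑ j, u j * z j) =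
      gaussianReal 0 (Real.toNNReal (∑ j, ∑ k, u j * S j k * u k)) := by
  rw [Measure.map_map (by fun_prop) hG, ← h u]
  rfl

lemma IsCenteredGaussianVec.isGaussian_map (h : IsCenteredGaussianVec P G S)
    (hG : Measurable G) : IsGaussian (P.map G) := by
  refine isGaussian_of_map_eq_gaussianReal fun L => ⟨0,
    Real.toNNReal (∑ j, ∑ k, L (Pi.single j 1) * S j k * L (Pi.single k 1)), ?_⟩
  rw [← h.map_sum_mul hG fun j => L (Pi.single j 1)]
  congr 1
  ext z
  conv_lhs => rw [← Finset.univ_sum_single z, map_sum]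
  refine Finset.sum_congr rfl fun j _ => ?_
  have : (Pi.single j (z j) : Fin p → ℝ) = z j • Pi.single j 1 := by
    rw [← Pi.single_smul]; simp
  rw [this, map_smul, smul_eq_mul, mul_comm]

lemma IsCenteredGaussianVec.variance_sum_mul (h : IsCenteredGaussianVec P G S)
    (hG : Measurable G) (u : Fin p → ℝ) (hu : 0 ≤ ∑ j, ∑ k, u j * S j k * u k) :
    Var[fun z => ∑ j, u j * z j; P.map G] = ∑ j, ∑ k, u j * S j k * u k := by
  have := variance_map (X := id) (Y := fun z : Fin p → ℝ => ∑ j, u j * z j) (μ := P.map G)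
    aemeasurable_id (Measurable.aemeasurable (by fun_prop))
  rw [h.map_sum_mul hG, variance_id_gaussianReal, Real.coe_toNNReal _ hu] at this
  exact this.symm

lemma IsCenteredGaussianVec.integral_eval (h : IsCenteredGaussianVec P G S)
    (hG : Measurable G) (j : Fin p) : ∫ z, z j ∂(P.map G) = 0 := by
  have := integral_map (φ := fun z : Fin p → ℝ => ∑ i, (Pi.single j 1 : Fin p → ℝ) i * z i)
    (μ := P.map G) (f := id) (Measurable.aemeasurable (by fun_prop))
    aestronglyMeasurable_id
  rw [h.map_sum_mul hG] at this
  simpa [Pi.single_apply, integral_id_gaussianReal] using this.symm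

lemma IsCenteredGaussianVec.variance_eval (h : IsCenteredGaussianVec P G S)
    (hG : Measurable G) {j : Fin p} (hj : 0 ≤ S j j) : Var[fun z => z j; P.map G] = S j j := by
  have := h.variance_sum_mul hG (Pi.single j 1) (by simpa [Pi.single_apply] using hj)
  simpa [Pi.single_apply] using this

lemma IsCenteredGaussianVec.add_swap_eq_two_mul_covariance (h : IsCenteredGaussianVec P G S)
    (hG : Measurable G) (hS : ∀ j, 0 < S j j) (j k : Fin p) :
    S j k + S k j = 2 * cov[fun z => z j, fun z => z k; P.map G] := by
  have hgauss := h.isGaussian_map hG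
  have hid : HasGaussianLaw (id : (Fin p → ℝ) → (Fin p → ℝ)) (P.map G) :=
    IsGaussian.hasGaussianLaw_id
  have hmem : ∀ j, MemLp (fun z : Fin p → ℝ => z j) 2 (P.map G) := fun j =>
    (hid.map_fun (ContinuousLinearMap.proj j)).memLp_two
  set t : ℝ := 1 + |S j k + S k j| / S j j with ht
  have hSj := hS j
  have ht1 : 1 ≤ t := le_add_of_nonneg_right (by positivity)
  have htS : t * S j j = S j j + |S j k + S k j| := by rw [ht]; field_simp
  set u : Fin p → ℝ := fun i => t * (if i = j then 1 else 0) + if i = k then 1 else 0 with hu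
  have hquad : ∑ i, ∑ l, u i * S i l * u l =
      t ^ 2 * S j j + t * (S j k + S k j) + S k k := by
    simp only [hu, mul_add, add_mul, Finset.sum_add_distrib, mul_ite, ite_mul, mul_one, one_mul,
      mul_zero, zero_mul, Finset.sum_ite_eq', Finset.mem_univ, if_true]
    ring
  have hpos : 0 ≤ ∑ i, ∑ l, u i * S i l * u l := by
    have h1 : 0 ≤ t * (S j j + |S j k + S k j| + (S j k + S k j)) :=
      mul_nonneg (by linarith) (by linarith [neg_abs_le (S j k + S k j)])
    rw [hquad, pow_two, mul_assoc, htS]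
    linarith [hS k]
  have hlin : (fun z : Fin p → ℝ => ∑ i, u i * z i) = fun z => t * z j + z k := by
    ext z
    simp [hu, add_mul, Finset.sum_add_distrib]
  have hvar := h.variance_sum_mul hG u hpos
  rw [hquad, hlin, variance_fun_add ((hmem j).const_mul t) (hmem k), variance_const_mul,
    covariance_const_mul_left, h.variance_eval hG hSj.le, h.variance_eval hG (hS k).le] at hvar
  have h2 : t * (S j k + S k j) = t * (2 * cov[fun z => z j, fun z => z k; P.map G]) := by
    linarith
  exact mul_left_cancel₀ (by positivity) h2

end CenteredGaussian

lemma IsSteinKernel.map {Ω : Type} [MeasurableSpace Ω] {P : Measure Ω} {p : ℕ}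
    {V : Ω → Fin p → ℝ} (hV : Measurable V) {τ : (Fin p → ℝ) → Fin p → Fin p → ℝ}
    (hτm : Measurable τ) (hτ : IsSteinKernel P V τ) : IsSteinKernel (P.map V) id τ := by
  intro φ hφ
  have h := hτ φ hφ
  have h1 : ∀ j, Measurable (pderiv1 φ j) := fun j => (hφ.1.pderiv1_contDiff j).continuous.measurable
  have h2 : ∀ j k, Measurable (pderiv2 φ j k) := fun j k => (hφ.1.pderiv2_continuous j k).measurable
  have h3 : ∀ j k, Measurable fun v => τ v j k := fun j k => by fun_prop
  simp only [id]
  rw [Finset.sum_congr rfl fun j _ => integral_map (f := fun v => pderiv1 φ j v * v j)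
      hV.aemeasurable ((h1 j).mul (measurable_pi_apply j)).aestronglyMeasurable, h]
  refine Finset.sum_congr rfl fun j _ => Finset.sum_congr rfl fun k _ => ?_
  rw [integral_map (f := fun v => pderiv2 φ j k v * τ v j k) hV.aemeasurable
    ((h2 j k).mul (h3 j k)).aestronglyMeasurable]

lemma le_iSup_iSup_of_finite {ι κ : Type*} [Finite ι] [Finite κ] (f : ι → κ → ℝ) (i : ι) (k : κ) :
    f i k ≤ ⨆ i, ⨆ k, f i k :=
  (le_ciSup (Set.finite_range (f i)).bddAbove k).trans
    (le_ciSup (f := fun i => ⨆ k, f i k) (Set.finite_range _).bddAbove i)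

/-- **Gaussian approximation via Stein kernels** (Theorem 5.1). If the centered
random vector `V` admits a Stein kernel `τ` and `Z` is a centered Gaussian vector
with covariance `Σ` satisfying `Σ_{jj} ≥ c`, then
`sup_y |P(V ≤ y) − P(Z ≤ y)| ≤ C (Δ log² p)^{1/2}`, with
`Δ = E[max_{j,k} |τ_{jk}(V) − Σ_{jk}|]` and `C` depending only on `c`. -/
theorem gaussian_approximation_stein_kernel (c : ℝ) (hc : 0 < c) :
    ∃ C : ℝ, 0 < C ∧
      ∀ (p : ℕ), 2 ≤ p →
      ∀ (Ω : Type) (_ : MeasurableSpace Ω) (P : Measure Ω) (_ : IsProbabilityMeasure P)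
        (V : Ω → Fin p → ℝ), Measurable V →
        (∀ j, Integrable (fun ω => V ω j) P) →
        (∀ j, ∫ ω, V ω j ∂P = 0) →
      ∀ (τ : (Fin p → ℝ) → Fin p → Fin p → ℝ), Measurable τ →
        IsSteinKernel P V τ →
      ∀ (S : Fin p → Fin p → ℝ), (∀ j, c ≤ S j j) →
      ∀ (Ω' : Type) (_ : MeasurableSpace Ω') (P' : Measure Ω') (_ : IsProbabilityMeasure P')
        (Z : Ω' → Fin p → ℝ), Measurable Z →
        IsCenteredGaussianVec P' Z S →
        Integrable (fun ω => ⨆ j, ⨆ k, |τ (V ω) j k - S j k|) P →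
      ∀ y : Fin p → ℝ,
        |(P {ω | ∀ j, V ω j ≤ y j}).toReal - (P' {ω' | ∀ j, Z ω' j ≤ y j}).toReal| ≤
          C * ((∫ ω, ⨆ j, ⨆ k, |τ (V ω) j k - S j k| ∂P) *
            Real.log p ^ 2) ^ ((1 : ℝ) / 2) := by

  obtain ⟨K, hK, hmain⟩ := exists_abs_measureReal_Iic_sub_le hc
  refine ⟨K, hK, ?_⟩
  intro p hp Ω _ P _ V hV hVi _ τ hτm hτ S hS Ω' _ P' _ Z hZ hG hDi y
  have hS0 : ∀ j, 0 < S j j := fun j => hc.trans_le (hS j)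
  have hgauss := hG.isGaussian_map hZ
  have hvar : ∀ j, Var[fun z => z j; P'.map Z] = S j j := fun j =>
    hG.variance_eval hZ (hS0 j).le
  set D : (Fin p → ℝ) → ℝ := fun v => ⨆ j, ⨆ k, |τ v j k - S j k| with hD
  have hτjk : ∀ j k, Measurable fun v => τ v j k := fun j k => by fun_prop
  have hDm : Measurable D := Measurable.iSup fun j => Measurable.iSup fun k =>
    ((hτjk j k).sub_const _).abs
  have hDle : ∀ v j k, |τ v j k - S j k| ≤ D v := fun v j k =>
    le_iSup_iSup_of_finite (fun j k => |τ v j k - S j k|) j k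
  have hDi' : Integrable D (P.map V) :=
    (integrable_map_measure hDm.aestronglyMeasurable hV.aemeasurable).2 hDi
  have hprob : IsProbabilityMeasure (P.map V) := Measure.isProbabilityMeasure_map hV.aemeasurable
  have hτi : ∀ j k, Integrable (fun v => τ v j k) (P.map V) := fun j k => by
    have h1 : Integrable (fun v => τ v j k - S j k) (P.map V) :=
      hDi'.mono' ((hτjk j k).sub_const _).aestronglyMeasurable (.of_forall fun v => hDle v j k)
    exact (h1.add (integrable_const (S j k))).congr (.of_forall fun v => sub_add_cancel _ _)
  have hμ : ∀ j, Integrable (fun v => v j) (P.map V) := fun j =>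
    (integrable_map_measure (measurable_pi_apply j).aestronglyMeasurable hV.aemeasurable).2 (hVi j)
  have hSZ : IsSteinKernel (P'.map Z) id (fun _ => S) :=
    isSteinKernel_of_isGaussian _ (hG.integral_eval hZ)
      (fun j => by rw [hvar j]; exact (hS0 j).ne') (hG.add_swap_eq_two_mul_covariance hZ hS0)
  have h := hmain p hp (P.map V) (P'.map Z) hprob hgauss hμ (hG.integral_eval hZ)
    (fun j => by rw [hvar j]; exact hS j) τ S hτi (hτ.map hV hτm) hSZ D hDi' hDle y
  rwa [integral_map hV.aemeasurable hDm.aestronglyMeasurable,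
    map_measureReal_apply hV measurableSet_Iic, map_measureReal_apply hZ measurableSet_Iic] at h
end

section
/- Let a_1,…,a_n be real constants and let X_1,…,X_n be exchangeable random variables with |X_i| ≤ 1 almost surely for all i. Then for every t > 0, P( |Σ_{i=1}^n a_i X_i| > |Σ_{i=1}^n a_i| + t ) ≤ 2 exp( − t² / (32 Σ_{i=1}^n a_i²) ). -/
open MeasureTheory ProbabilityTheory

lemma sub_mul_exp_sub_exp_le {l : ℝ} (hl : 0 ≤ l) (u v : ℝ) :
    (u - v) * (Real.exp (l * u) - Real.exp (l * v)) ≤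
      l * (u - v) ^ 2 * (Real.exp (l * u) + Real.exp (l * v)) := by
  have key : ∀ x y : ℝ, y ≤ x → (x - y) * (Real.exp (l * x) - Real.exp (l * y)) ≤
      l * (x - y) ^ 2 * (Real.exp (l * x) + Real.exp (l * y)) := by
    intro x y hxy
    have h1 : Real.exp (l * x) - Real.exp (l * y) ≤ Real.exp (l * x) * (l * (x - y)) := by
      have h2 := Real.add_one_le_exp (l * y - l * x)
      have h3 : Real.exp (l * y) = Real.exp (l * x) * Real.exp (l * y - l * x) := by
        rw [← Real.exp_add]; congr 1; ring
      nlinarith [Real.exp_pos (l * x)]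
    calc (x - y) * (Real.exp (l * x) - Real.exp (l * y))
        ≤ (x - y) * (Real.exp (l * x) * (l * (x - y))) :=
          mul_le_mul_of_nonneg_left h1 (sub_nonneg.2 hxy)
      _ = l * (x - y) ^ 2 * Real.exp (l * x) := by ring
      _ ≤ _ := by
          gcongr
          exact le_add_of_nonneg_right (Real.exp_pos _).le
  rcases le_total v u with h | h
  · exact key u v h
  · have := key v u h
    linarith [show (v - u) ^ 2 = (u - v) ^ 2 by ring,
      show l * (v - u) ^ 2 * (Real.exp (l * v) + Real.exp (l * u)) =
        l * (u - v) ^ 2 * (Real.exp (l * u) + Real.exp (l * v)) by ring]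

section Exchangeable

variable {Ω ι : Type*} [MeasurableSpace Ω] {P : Measure Ω} {X : ι → Ω → ℝ}

lemma integral_comp_perm_of_exchangeable (hmeas : ∀ i, Measurable (X i))
    (hexch : ∀ π : Equiv.Perm ι,
      Measure.map (fun ω i => X (π i) ω) P = Measure.map (fun ω i => X i ω) P)
    (π : Equiv.Perm ι) {g : (ι → ℝ) → ℝ} (hg : Measurable g) :
    ∫ ω, g (fun i => X (π i) ω) ∂P = ∫ ω, g (fun i => X i ω) ∂P := by
  rw [← integral_map (φ := fun ω i => X (π i) ω)
      (measurable_pi_lambda _ fun i => hmeas (π i)).aemeasurable hg.aestronglyMeasurable,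
    hexch π, integral_map (measurable_pi_lambda _ hmeas).aemeasurable hg.aestronglyMeasurable]

variable [Fintype ι]

lemma abs_sum_mul_le_sum_abs {x : ι → ℝ} (b : ι → ℝ) (hx : ∀ i, |x i| ≤ 1) :
    |∑ i, b i * x i| ≤ ∑ i, |b i| := by
  refine (Finset.abs_sum_le_sum_abs _ _).trans (Finset.sum_le_sum fun i _ => ?_)
  rw [abs_mul]
  exact mul_le_of_le_one_right (abs_nonneg _) (hx i)

lemma integrable_exp_mul_sum_of_bounded [IsFiniteMeasure P] (hmeas : ∀ i, Measurable (X i))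
    (hbdd : ∀ i, ∀ᵐ ω ∂P, |X i ω| ≤ 1) (b : ι → ℝ) (l : ℝ) :
    Integrable (fun ω => Real.exp (l * ∑ i, b i * X i ω)) P := by
  refine integrable_exp_mul_of_mem_Icc (a := -∑ i, |b i|) (b := ∑ i, |b i|)
    (by fun_prop) ?_
  filter_upwards [ae_all_iff.2 hbdd] with ω hω
  exact abs_le.1 (abs_sum_mul_le_sum_abs b hω)

lemma integral_swap_difference_le [IsFiniteMeasure P] (hmeas : ∀ i, Measurable (X i))
    (hexch : ∀ π : Equiv.Perm ι,
      Measure.map (fun ω i => X (π i) ω) P = Measure.map (fun ω i => X i ω) P)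
    (hbdd : ∀ i, ∀ᵐ ω ∂P, |X i ω| ≤ 1) (b : ι → ℝ) {l : ℝ} (hl : 0 ≤ l) (i j : ι) :
    Integrable (fun ω => (b i - b j) * (X i ω - X j ω) * Real.exp (l * ∑ k, b k * X k ω)) P ∧
    ∫ ω, (b i - b j) * (X i ω - X j ω) * Real.exp (l * ∑ k, b k * X k ω) ∂P ≤
      4 * l * (b i - b j) ^ 2 * ∫ ω, Real.exp (l * ∑ k, b k * X k ω) ∂P := by
  classical
  set σ := Equiv.swap i j with hσ
  set Y : Ω → ℝ := fun ω => ∑ k, b k * X k ω with hY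
  set Y' : Ω → ℝ := fun ω => ∑ k, b k * X (σ k) ω with hY'
  set D : Ω → ℝ := fun ω => (b i - b j) * (X i ω - X j ω) with hD
  have hdiff : ∀ ω, Y ω - Y' ω = D ω := by
    intro ω
    simp only [hY, hY', hD, ← Finset.sum_sub_distrib, ← mul_sub]
    by_cases hij : i = j
    · subst hij; simp [hσ]
    rw [← Finset.sum_subset (Finset.subset_univ {i, j}), Finset.sum_pair hij]
    · simp [hσ]; ring
    · intro k _ hk
      simp only [Finset.mem_insert, Finset.mem_singleton, not_or] at hk
      simp [hσ, Equiv.swap_apply_of_ne_of_ne hk.1 hk.2]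
  have hDm : Measurable D := by fun_prop
  have hDb : ∀ᵐ ω ∂P, |X i ω - X j ω| ≤ 2 := by
    filter_upwards [hbdd i, hbdd j] with ω h1 h2
    exact (abs_sub _ _).trans (by linarith)
  have hI : Integrable (fun ω => Real.exp (l * Y ω)) P :=
    integrable_exp_mul_sum_of_bounded hmeas hbdd b l
  have hI' : Integrable (fun ω => Real.exp (l * Y' ω)) P :=
    integrable_exp_mul_sum_of_bounded (X := fun k => X (σ k)) (fun k => hmeas _)
      (fun k => hbdd _) b l
  have hDbd : ∀ᵐ ω ∂P, ‖D ω‖ ≤ |b i - b j| * 2 := by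
    filter_upwards [hDb] with ω h
    rw [Real.norm_eq_abs, abs_mul]
    gcongr
  have hDI := hI.bdd_mul hDm.aestronglyMeasurable hDbd
  have hDI' := hI'.bdd_mul hDm.aestronglyMeasurable hDbd
  have e1 : ∫ ω, Real.exp (l * Y' ω) ∂P = ∫ ω, Real.exp (l * Y ω) ∂P :=
    integral_comp_perm_of_exchangeable hmeas hexch σ
      (g := fun x => Real.exp (l * ∑ k, b k * x k)) (by fun_prop)
  have e2 : -∫ ω, D ω * Real.exp (l * Y' ω) ∂P = ∫ ω, D ω * Real.exp (l * Y ω) ∂P := by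
    rw [← integral_comp_perm_of_exchangeable hmeas hexch σ
      (g := fun x => (b i - b j) * (x i - x j) * Real.exp (l * ∑ k, b k * x k)) (by fun_prop),
      ← integral_neg]
    congr 1 with ω
    simp only [hσ, Equiv.swap_apply_left, Equiv.swap_apply_right, hD, hY']
    ring
  have hle : ∫ ω, (D ω * Real.exp (l * Y ω) - D ω * Real.exp (l * Y' ω)) ∂P ≤
      ∫ ω, 4 * l * (b i - b j) ^ 2 * (Real.exp (l * Y ω) + Real.exp (l * Y' ω)) ∂P := by
    refine integral_mono_ae (hDI.sub hDI') ((hI.add hI').const_mul _) ?_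
    filter_upwards [hDb] with ω h
    have h1 := sub_mul_exp_sub_exp_le hl (Y ω) (Y' ω)
    rw [hdiff, mul_sub] at h1
    refine h1.trans ?_
    have h2 : (X i ω - X j ω) ^ 2 ≤ 4 := by
      rw [← sq_abs]; nlinarith [abs_nonneg (X i ω - X j ω)]
    have h3 : D ω ^ 2 ≤ 4 * (b i - b j) ^ 2 := by
      simp only [hD, mul_pow]; nlinarith [sq_nonneg (b i - b j)]
    calc _ ≤ l * (4 * (b i - b j) ^ 2) * (Real.exp (l * Y ω) + Real.exp (l * Y' ω)) := by gcongr
      _ = _ := by ring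
  rw [integral_sub hDI hDI', integral_const_mul, integral_add hI hI', e1] at hle
  exact ⟨hDI, by linarith⟩

lemma integral_sum_mul_exp_le [Nonempty ι] [IsFiniteMeasure P] (hmeas : ∀ i, Measurable (X i))
    (hexch : ∀ π : Equiv.Perm ι,
      Measure.map (fun ω i => X (π i) ω) P = Measure.map (fun ω i => X i ω) P)
    (hbdd : ∀ i, ∀ᵐ ω ∂P, |X i ω| ≤ 1) {b : ι → ℝ} (hb : ∑ i, b i = 0) {l : ℝ} (hl : 0 ≤ l) :
    ∫ ω, (∑ k, b k * X k ω) * Real.exp (l * ∑ k, b k * X k ω) ∂P ≤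
      4 * l * (∑ i, b i ^ 2) * ∫ ω, Real.exp (l * ∑ k, b k * X k ω) ∂P := by
  have hsum : ∀ x : ι → ℝ, ∑ i, ∑ j, (b i - b j) * (x i - x j) =
      2 * Fintype.card ι * ∑ k, b k * x k := by
    intro x
    simp only [sub_mul, mul_sub, Finset.sum_sub_distrib, Finset.sum_const, Finset.card_univ,
      nsmul_eq_mul, ← Finset.mul_sum, ← Finset.sum_mul, hb]
    ring
  have hle := Finset.sum_le_sum fun i (_ : i ∈ Finset.univ) =>
    Finset.sum_le_sum fun j (_ : j ∈ Finset.univ) =>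
      (integral_swap_difference_le hmeas hexch hbdd b hl i j).2
  have hint := fun i j => (integral_swap_difference_le hmeas hexch hbdd b hl i j).1
  have hL : ∑ i, ∑ j, ∫ ω, (b i - b j) * (X i ω - X j ω) *
      Real.exp (l * ∑ k, b k * X k ω) ∂P = 2 * Fintype.card ι *
        ∫ ω, (∑ k, b k * X k ω) * Real.exp (l * ∑ k, b k * X k ω) ∂P := by
    rw [← integral_const_mul]
    simp_rw [← mul_assoc, ← hsum, Finset.sum_mul]
    rw [integral_finsetSum _ fun i _ => integrable_finsetSum _ fun j _ => hint i j]
    exact Finset.sum_congr rfl fun i _ => (integral_finsetSum _ fun j _ => hint i j).symm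
  have hR : ∑ i, ∑ j, (b i - b j) ^ 2 = 2 * Fintype.card ι * ∑ k, b k ^ 2 := by
    simpa only [pow_two] using hsum b
  rw [hL] at hle
  simp_rw [← Finset.sum_mul, ← Finset.mul_sum] at hle
  rw [hR] at hle
  have hpos : (0 : ℝ) < 2 * Fintype.card ι := by
    have : (0 : ℝ) < Fintype.card ι := by exact_mod_cast Fintype.card_pos
    positivity
  refine le_of_mul_le_mul_left (hle.trans_eq ?_) hpos
  ring

lemma mgf_sum_le_of_exchangeable [Nonempty ι] [IsProbabilityMeasure P]
    (hmeas : ∀ i, Measurable (X i))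
    (hexch : ∀ π : Equiv.Perm ι,
      Measure.map (fun ω i => X (π i) ω) P = Measure.map (fun ω i => X i ω) P)
    (hbdd : ∀ i, ∀ᵐ ω ∂P, |X i ω| ≤ 1) {b : ι → ℝ} (hb : ∑ i, b i = 0) {l : ℝ} (hl : 0 ≤ l) :
    mgf (fun ω => ∑ k, b k * X k ω) P l ≤ Real.exp (2 * (∑ i, b i ^ 2) * l ^ 2) := by
  set Y : Ω → ℝ := fun ω => ∑ k, b k * X k ω with hY
  set S := ∑ i, b i ^ 2
  have huniv : integrableExpSet Y P = Set.univ :=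
    Set.eq_univ_of_forall fun s => integrable_exp_mul_sum_of_bounded hmeas hbdd b s
  have hm : ∀ s, HasDerivAt (mgf Y P) (∫ ω, Y ω * Real.exp (s * Y ω) ∂P) s := fun s =>
    hasDerivAt_mgf (by simp [huniv])
  have he : ∀ s : ℝ, HasDerivAt (fun s => Real.exp (-(2 * S * s ^ 2)))
      (Real.exp (-(2 * S * s ^ 2)) * -(2 * S * (2 * s))) s := fun s => by
    simpa using (((hasDerivAt_pow 2 s).const_mul (2 * S)).neg).exp
  have hd := fun s => (hm s).mul (he s)
  have hanti : AntitoneOn (mgf Y P * fun s => Real.exp (-(2 * S * s ^ 2))) (Set.Ici 0) := by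
    refine antitoneOn_of_deriv_nonpos (convex_Ici 0)
      (fun s _ => (hd s).continuousAt.continuousWithinAt)
      (fun s _ => (hd s).differentiableAt.differentiableWithinAt) fun s hs => ?_
    rw [interior_Ici] at hs
    rw [(hd s).deriv]
    have h : ∫ ω, Y ω * Real.exp (s * Y ω) ∂P ≤ 4 * s * S * mgf Y P s :=
      integral_sum_mul_exp_le hmeas hexch hbdd hb (le_of_lt hs)
    nlinarith [Real.exp_pos (-(2 * S * s ^ 2))]
  have h0 := hanti (Set.mem_Ici.2 le_rfl) (Set.mem_Ici.2 hl) hl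
  simp only [Pi.mul_apply, mgf_zero, Real.exp_neg] at h0
  norm_num at h0
  rwa [← div_eq_mul_inv, div_le_one (Real.exp_pos _)] at h0

lemma measureReal_sum_ge_le_of_exchangeable [Nonempty ι] [IsProbabilityMeasure P]
    (hmeas : ∀ i, Measurable (X i))
    (hexch : ∀ π : Equiv.Perm ι,
      Measure.map (fun ω i => X (π i) ω) P = Measure.map (fun ω i => X i ω) P)
    (hbdd : ∀ i, ∀ᵐ ω ∂P, |X i ω| ≤ 1) {b : ι → ℝ} (hb : ∑ i, b i = 0) {S t : ℝ}
    (hS : 0 < S) (hbS : ∑ i, b i ^ 2 ≤ S) (ht : 0 ≤ t) :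
    P.real {ω | t ≤ ∑ k, b k * X k ω} ≤ Real.exp (-t ^ 2 / (8 * S)) := by
  have hl : 0 ≤ t / (4 * S) := by positivity
  refine (measure_ge_le_exp_mul_mgf t hl
    (integrable_exp_mul_sum_of_bounded hmeas hbdd b _)).trans ?_
  refine (mul_le_mul_of_nonneg_left (mgf_sum_le_of_exchangeable hmeas hexch hbdd hb hl)
    (Real.exp_pos _).le).trans ?_
  rw [← Real.exp_add, Real.exp_le_exp]
  calc _ ≤ -(t / (4 * S)) * t + 2 * S * (t / (4 * S)) ^ 2 := by gcongr
    _ = _ := by field_simp; ring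

end Exchangeable

/-- **Exponential inequality for weighted sums of exchangeable random variables.**
Let `a 1, …, a n` be real constants and let `X 1, …, X n` be exchangeable random
variables with `|X i| ≤ 1` almost surely. Then for every `t > 0`,
`P(|∑ a i * X i| > |∑ a i| + t) ≤ 2 exp(−t² / (32 ∑ a i²))`. -/
theorem exchangeable_weighted_sum_exponential_inequality
    {Ω : Type} [MeasurableSpace Ω] (P : Measure Ω) [IsProbabilityMeasure P]
    (n : ℕ) (a : Fin n → ℝ) (X : Fin n → Ω → ℝ)
    (hmeas : ∀ i, Measurable (X i))
    (hexch : ∀ π : Equiv.Perm (Fin n),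
      Measure.map (fun ω (i : Fin n) => X (π i) ω) P =
        Measure.map (fun ω (i : Fin n) => X i ω) P)
    (hbdd : ∀ i, ∀ᵐ ω ∂P, |X i ω| ≤ 1) :
    ∀ t : ℝ, 0 < t →
      (P {ω | |∑ i, a i| + t < |∑ i, a i * X i ω|}).toReal ≤
        2 * Real.exp (-t ^ 2 / (32 * ∑ i, (a i) ^ 2)) := by
  intro t ht
  have hS0 : 0 ≤ ∑ i, a i ^ 2 := Finset.sum_nonneg fun i _ => sq_nonneg _
  rcases hS0.eq_or_lt with hS | hS
  · rw [← hS, mul_zero, div_zero, Real.exp_zero]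
    exact measureReal_le_one.trans (by norm_num)
  have : Nonempty (Fin n) := by
    by_contra h
    rw [not_nonempty_iff] at h
    simp at hS
  have hn : (0 : ℝ) < n := by
    have := Fin.pos_iff_nonempty.2 this
    exact_mod_cast this
  set c := (∑ i, a i) / n with hc
  have hcn : n * c = ∑ i, a i := by rw [hc]; field_simp
  have hb : ∑ i, (a i - c) = 0 := by simp [hcn]
  have hb' : ∑ i, (c - a i) = 0 := by simp [hcn]
  have hbS : ∑ i, (a i - c) ^ 2 ≤ ∑ i, a i ^ 2 := by
    have : ∑ i, (a i - c) ^ 2 = ∑ i, a i ^ 2 - n * c ^ 2 := by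
      simp only [sub_sq, Finset.sum_add_distrib, Finset.sum_sub_distrib, ← Finset.sum_mul,
        ← Finset.mul_sum, ← hcn]
      simp
      ring
    rw [this]
    exact sub_le_self _ (by positivity)
  have hbS' : ∑ i, (c - a i) ^ 2 ≤ ∑ i, a i ^ 2 := by
    simpa only [sub_sq_comm c] using hbS
  have h1 := measureReal_sum_ge_le_of_exchangeable hmeas hexch hbdd hb hS hbS ht.le
  have h2 := measureReal_sum_ge_le_of_exchangeable hmeas hexch hbdd hb' hS hbS' ht.le
  have hsub : P.real {ω | |∑ i, a i| + t < |∑ i, a i * X i ω|} ≤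
      P.real ({ω | t ≤ ∑ i, (a i - c) * X i ω} ∪ {ω | t ≤ ∑ i, (c - a i) * X i ω}) := by
    refine ENNReal.toReal_mono (measure_ne_top _ _) (measure_mono_ae ?_)
    filter_upwards [ae_all_iff.2 hbdd] with ω hω (h : _ < _)
    have hmean : |∑ i, c * X i ω| ≤ |∑ i, a i| := by
      refine (abs_sum_mul_le_sum_abs _ hω).trans_eq ?_
      rw [← hcn, abs_mul, abs_of_pos hn]
      simp
    have hdev : t ≤ |∑ i, a i * X i ω - ∑ i, c * X i ω| := by
      linarith [abs_sub_abs_le_abs_sub (∑ i, a i * X i ω) (∑ i, c * X i ω)]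
    change t ≤ ∑ i, (a i - c) * X i ω ∨ t ≤ ∑ i, (c - a i) * X i ω
    simp only [sub_mul, Finset.sum_sub_distrib]
    rcases le_abs.1 hdev with h | h
    · exact Or.inl h
    · exact Or.inr (by linarith)
  have hexp : Real.exp (-t ^ 2 / (8 * ∑ i, a i ^ 2)) ≤
      Real.exp (-t ^ 2 / (32 * ∑ i, a i ^ 2)) := by
    rw [Real.exp_le_exp, neg_div, neg_div, neg_le_neg_iff]
    gcongr
    norm_num
  have := hsub.trans (measureReal_union_le _ _)
  change P.real _ ≤ _
  linarith
end
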